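/- Let n ≥ 3. Then every short exact sequence 0 → W → E → V → 0 of finite-dimensional ℚ-linear representations of GL_n(ℤ) splits; that is, there is a GL_n(ℤ)-equivariant linear map V → E that is a section of the surjection E → V. Equivalently, Ext¹ between finite-dimensional ℚ-representations of GL_n(ℤ) vanishes. -/

import Mathlib

namespace GLnZ
open Finset
set_option linter.unusedSectionVars false

/-! ### Part 1: polynomial sequences and exponentials of nilpotent elements -/

lemma coeff_zero_of_poly {M : Type*} [AddCommGroup M] [Module ℚ M] (d : ℕ) (c : ℕ → M)
    (h : ∀ m : ℕ, ∑ i ∈ range d, ((m : ℚ) ^ i) • c i = 0) (i : ℕ) (hi : i < d) : c i = 0 := by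
  rw [← Module.forall_dual_apply_eq_zero_iff ℚ]
  intro φ
  let p : Polynomial ℚ := ∑ i ∈ range d, Polynomial.monomial i (φ (c i))
  have hp : p = 0 := by
    apply Polynomial.eq_zero_of_infinite_isRoot
    apply Set.Infinite.mono (s := Set.range (fun m : ℕ => (m : ℚ)))
    · rintro _ ⟨m, rfl⟩
      have := congrArg φ (h m)
      simp only [map_sum, map_smul, smul_eq_mul, map_zero] at this
      simp only [Set.mem_ofPred_eq, Polynomial.IsRoot, p, Polynomial.eval_finsetSum,
        Polynomial.eval_monomial]
      rw [← this]
      exact sum_congr rfl fun i _ => mul_comm _ _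
    · exact Set.infinite_range_of_injective Nat.cast_injective
  have := congrArg (fun q => Polynomial.coeff q i) hp
  simpa [p, Polynomial.finsetSum_coeff, Polynomial.coeff_monomial, hi] using this

section Exp
variable {R : Type*} [Ring R] [Algebra ℚ R]
open IsNilpotent

lemma exp_pow (X : R) (hX : IsNilpotent X) (m : ℕ) : exp X ^ m = exp ((m : ℚ) • X) := by
  induction m with
  | zero => simp
  | succ m ih =>
    rw [_root_.pow_succ, ih, ← exp_add_of_commute ((Commute.refl X).smul_left _)
      (hX.smul _) hX]
    congr 1
    push_cast
    rw [add_smul, one_smul]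

lemma exp_pow_sum (X : R) (d : ℕ) (hX : X ^ d = 0) (m : ℕ) :
    exp X ^ m = ∑ i ∈ range d, ((m : ℚ) ^ i) • ((i.factorial : ℚ)⁻¹ • X ^ i) := by
  rw [exp_pow X ⟨d, hX⟩, exp_eq_sum (k := d)]
  · refine sum_congr rfl fun i _ => ?_
    rw [smul_pow, smul_comm]
  · rw [smul_pow, hX, smul_zero]

lemma pow_intertwine {R : Type*} [Monoid R] {u v t : R} (h : u * t = t * v) (m : ℕ) :
    u ^ m * t = t * v ^ m := by
  induction m with
  | zero => simp
  | succ m ih => rw [_root_.pow_succ, mul_assoc, h, ← mul_assoc, ih, mul_assoc, _root_.pow_succ]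

lemma exp_intertwine {X Y T : R} (hX : IsNilpotent X) (hY : IsNilpotent Y)
    (h : exp X * T = T * exp Y) : X * T = T * Y := by
  obtain ⟨a, ha⟩ := hX
  obtain ⟨b, hb⟩ := hY
  have ha' : X ^ (a + b + 2) = 0 := pow_eq_zero_of_le (by omega) ha
  have hb' : Y ^ (a + b + 2) = 0 := pow_eq_zero_of_le (by omega) hb
  have := coeff_zero_of_poly (a + b + 2)
    (fun i => (i.factorial : ℚ)⁻¹ • (X ^ i * T - T * Y ^ i)) ?_ 1 (by omega)
  · simpa [sub_eq_zero] using this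
  · intro m
    have hm := pow_intertwine h m
    rw [exp_pow_sum X _ ha', exp_pow_sum Y _ hb', sum_mul, mul_sum, ← sub_eq_zero,
      ← sum_sub_distrib] at hm
    rw [← hm]
    refine sum_congr rfl fun i _ => ?_
    simp only [smul_sub, smul_mul_assoc, mul_smul_comm]

lemma exp_lie {X T Z : R} (hX : IsNilpotent X)
    (h : ∀ m : ℕ, exp X ^ m * T = (T + (m : ℚ) • Z) * exp X ^ m) : X * T = T * X + Z := by
  obtain ⟨a, ha⟩ := hX
  have ha' : X ^ (a + 1) = 0 := pow_eq_zero_of_le (by omega) ha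
  have ha'' : X ^ (a + 2) = 0 := pow_eq_zero_of_le (by omega) ha
  have := coeff_zero_of_poly (a + 2)
    (fun i => (i.factorial : ℚ)⁻¹ • (X ^ i * T - T * X ^ i) -
      (if i = 0 then 0 else ((i-1).factorial : ℚ)⁻¹ • (Z * X ^ (i-1)))) ?_ 1 (by omega)
  · simp [sub_eq_zero] at this
    rw [← this]; abel
  · intro m
    have hm := h m
    rw [add_mul, ← sub_eq_zero, ← sub_sub] at hm
    refine Eq.trans ?_ hm
    simp only [smul_sub, sum_sub_distrib]
    congr 1
    · rw [exp_pow_sum X _ ha'', sum_mul, mul_sum]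
      simp only [smul_mul_assoc, mul_smul_comm]
    · rw [sum_range_succ', exp_pow_sum X _ ha', mul_sum]
      simp only [smul_mul_assoc, mul_smul_comm, smul_smul, Nat.add_sub_cancel]
      simp [smul_smul, pow_succ', mul_assoc]
      exact sum_congr rfl fun i _ => by congr 1; ring

lemma pow_lie {X T Z : R} (h : X * T = T * X + Z) (hZ : Commute X Z) (i : ℕ) :
    X ^ (i + 1) * T = T * X ^ (i + 1) + ((i + 1 : ℕ) : ℚ) • (Z * X ^ i) := by
  induction i with
  | zero => simp [h]
  | succ i ih =>
    rw [pow_succ', mul_assoc, ih, mul_add, ← mul_assoc, h, mul_smul_comm, ← mul_assoc X Z, hZ.eq,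
      mul_assoc Z, ← pow_succ', add_mul, mul_assoc, ← pow_succ', pow_succ' X (i+1)]
    push_cast
    rw [add_smul _ (1:ℚ), one_smul, add_right_comm, add_assoc]
    simp only [add_smul, one_smul]

lemma exp_conj {X T Z : R} (hX : IsNilpotent X) (h : X * T = T * X + Z) (hZ : Commute X Z) :
    exp X * T = (T + Z) * exp X := by
  obtain ⟨a, ha⟩ := hX
  have ha'' : X ^ (a + 1) = 0 := pow_eq_zero_of_le (by omega) ha
  rw [add_mul]
  nth_rw 1 [exp_eq_sum ha'']
  nth_rw 1 [exp_eq_sum ha'']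
  rw [exp_eq_sum ha, sum_range_succ', add_mul, mul_add, sum_mul, mul_sum, mul_sum]
  simp only [smul_mul_assoc, mul_smul_comm, pow_lie h hZ]
  rw [add_right_comm]
  simp only [pow_zero, one_mul, mul_one, smul_add, sum_add_distrib]
  congr 2
  refine sum_congr rfl fun i _ => ?_
  rw [smul_smul]
  congr 1
  rw [Nat.factorial_succ]
  push_cast
  field_simp

lemma exists_log {u : R} (hu : IsNilpotent (u - 1)) : ∃ X : R, IsNilpotent X ∧ exp X = u := by
  obtain ⟨n, rfl⟩ : ∃ n, u = 1 + n := ⟨u - 1, by abel⟩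
  rw [add_sub_cancel_left] at hu
  obtain ⟨K, hK⟩ := hu
  have hnil : ∀ p : Polynomial ℚ, IsNilpotent (Polynomial.aeval n (Polynomial.X * p)) := by
    intro p
    rw [map_mul, Polynomial.aeval_X]
    have : Commute n (Polynomial.aeval n p) := by
      simpa using (Commute.all (Polynomial.X : Polynomial ℚ) p).map (Polynomial.aeval n)
    exact this.isNilpotent_mul_right ⟨K, hK⟩
  have key : ∀ k : ℕ, ∃ p q : Polynomial ℚ, exp (Polynomial.aeval n (Polynomial.X * p)) *
      (Polynomial.aeval n (1 + Polynomial.X ^ (k + 1) * q)) = 1 + n := by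
    intro k
    induction k with
    | zero => exact ⟨0, 1, by simp⟩
    | succ k ih =>
      obtain ⟨p, q, h⟩ := ih
      set Y : Polynomial ℚ := Polynomial.X ^ (k + 1) * q with hY
      have hYn : IsNilpotent (Polynomial.aeval n Y) := by
        have := hnil (Polynomial.X ^ k * q)
        rwa [← mul_assoc, ← pow_succ'] at this
      obtain ⟨b, hb⟩ := hYn
      have hb' : (Polynomial.aeval n (-Y)) ^ (b + 2) = 0 := by
        rw [map_neg, neg_pow, pow_eq_zero_of_le (by omega) hb, mul_zero]
      obtain ⟨s, hs⟩ : ∃ s : Polynomial ℚ, exp (Polynomial.aeval n (-Y)) =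
          Polynomial.aeval n (1 - Y + Y ^ 2 * s) := by
        refine ⟨∑ i ∈ range b, ((i+2).factorial : ℚ)⁻¹ • (-Y) ^ i, ?_⟩
        rw [exp_eq_sum hb', sum_range_succ', sum_range_succ', mul_sum, map_add, map_sum]
        simp only [map_mul, map_smul, map_pow, map_neg, map_sub, map_one, mul_smul_comm]
        rw [add_assoc, add_comm]
        congr 1
        · simp; abel
        · refine sum_congr rfl fun i _ => ?_
          rw [add_assoc, ← neg_sq, ← pow_add, add_comm 2 i]
      refine ⟨p + Polynomial.X ^ k * q, Polynomial.X ^ k * q ^ 2 * (-1 + s + Y * s), ?_⟩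
      have e1 : Polynomial.X * (p + Polynomial.X ^ k * q) = Polynomial.X * p + Y := by
        rw [hY]; ring
      have e2 : (1 : Polynomial ℚ) + Polynomial.X ^ (k + 1 + 1) * (Polynomial.X ^ k * q ^ 2 * (-1 + s + Y * s))
          = (1 - Y + Y ^ 2 * s) * (1 + Y) := by
        rw [hY]; ring
      rw [e1, e2, map_add, map_mul (Polynomial.aeval n) _ (1 + Y), ← hs, exp_add_of_commute _ (hnil p) ⟨b, hb⟩, map_neg,
        mul_assoc, ← mul_assoc (exp (Polynomial.aeval n Y)), exp_mul_exp_neg_self ⟨b, hb⟩, one_mul, h]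
      exact (Commute.all _ _).map (Polynomial.aeval n)
  obtain ⟨p, q, h⟩ := key K
  refine ⟨_, hnil p, ?_⟩
  have e : Polynomial.aeval n (1 + Polynomial.X ^ (K + 1) * q) = 1 := by
    simp [_root_.pow_succ, hK]
  rwa [e, mul_one] at h

end Exp

/-! ### Part 2: Steinberg families of operators and the Casimir operator -/

/-- The relations satisfied by the off-diagonal elementary matrices of `sl_n`. -/
structure Stein {ι R : Type*} [Ring R] (X : ι → ι → R) : Prop where
  lie : ∀ i j k, i ≠ j → j ≠ k → i ≠ k → X i j * X j k = X j k * X i j + X i k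
  comm : ∀ i j k l, i ≠ j → k ≠ l → j ≠ k → i ≠ l → Commute (X i j) (X k l)

/-- The relations satisfied by all elementary matrices of `gl_n`. -/
def GlRel {ι R : Type*} [DecidableEq ι] [Ring R] (E : ι → ι → R) : Prop :=
  ∀ i j k l, E i j * E k l = E k l * E i j + (if j = k then E i l else 0) - (if i = l then E k j else 0)

section
variable {ι R : Type*} [Ring R] {X : ι → ι → R} 

/-- coroot -/
def HH (X : ι → ι → R) (i j : ι) : R := X i j * X j i - X j i * X i j

lemma HH_self (i : ι) : HH X i i = 0 := by simp [HH]
lemma HH_swap (i j : ι) : HH X j i = - HH X i j := by simp [HH]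

lemma HH_add (hX : Stein X) {i j k : ι} (hij : i ≠ j) (hjk : j ≠ k) (hik : i ≠ k) :
    HH X i j + HH X j k = HH X i k := by
  have h1 := hX.lie i j k hij hjk hik
  have h2 := hX.lie j k i hjk hik.symm hij.symm
  have h3 := hX.lie k i j hik.symm hij hjk.symm
  have e1 : X i k = X i j * X j k - X j k * X i j := by rw [h1]; abel
  have e2 : X j i = X j k * X k i - X k i * X j k := by rw [h2]; abel
  have e3 : X k j = X k i * X i j - X i j * X k i := by rw [h3]; abel
  simp only [HH]
  rw [e1, e2, e3]
  noncomm_ring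

lemma HH_lie_right (hX : Stein X) {i j k : ι} (hij : i ≠ j) (hjk : j ≠ k) (hik : i ≠ k) :
    HH X i k * X i j = X i j * HH X i k + X i j := by
  have h3 := hX.lie k i j hik.symm hij hjk.symm
  have h4 := hX.lie i k j hik hjk.symm hij
  have h5 := (hX.comm i k i j hik hij hik.symm hij).eq
  have e3 : X k j = X k i * X i j - X i j * X k i := by rw [h3]; abel
  have e4 : X i j = X i k * X k j - X k j * X i k := by rw [h4]; abel
  have : HH X i k * X i j - X i j * HH X i k =
    X i k * X k j - X k j * X i k + X k i * (X i j * X i k) - X k i * (X i k * X i j)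
     + (X i k * X i j) * X k i - (X i j * X i k) * X k i := by
    simp only [HH]
    rw [e3]
    noncomm_ring
  rw [h5, ← e4] at this
  rw [← sub_eq_iff_eq_add', this]
  abel

lemma HH_lie_left (hX : Stein X) {i j k : ι} (hij : i ≠ j) (hjk : j ≠ k) (hik : i ≠ k) :
    HH X i k * X j i = X j i * HH X i k - X j i := by
  have h3 := hX.lie j i k hij.symm hik hjk
  have h4 := hX.lie j k i hjk hik.symm hij.symm
  have h5 := (hX.comm k i j i hik.symm hij.symm hij hik.symm).eq
  have e3 : X j k = X j i * X i k - X i k * X j i := by rw [h3]; abel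
  have e4 : X j i = X j k * X k i - X k i * X j k := by rw [h4]; abel
  have : X j i * HH X i k - HH X i k * X j i =
    X j k * X k i - X k i * X j k + (X k i * X j i) * X i k - (X j i * X k i) * X i k
     + X i k * (X j i * X k i) - X i k * (X k i * X j i) := by
    simp only [HH]
    rw [e3]
    noncomm_ring
  rw [h5, ← e4] at this
  rw [eq_sub_iff_add_eq', ← eq_sub_iff_add_eq, this]
  abel

variable [DecidableEq ι]

/-- the weight of `X k l` under the coroot `HH i j` -/
def wt (i j k l : ι) : ℤ :=
  (if i = k then 1 else 0) - (if i = l then 1 else 0) - (if j = k then 1 else 0)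
    + (if j = l then 1 else 0)

lemma HH_weight_aux (hX : Stein X) {i j k l : ι} (hij : i ≠ j) (hkl : k ≠ l)
    (h1 : ¬ (i = k ∧ j = l)) (h2 : ¬ (i = l ∧ j = k)) :
    HH X i j * X k l = X k l * HH X i j + wt i j k l • X k l := by
  by_cases hik : i = k
  · subst hik
    have hjl : j ≠ l := fun h => h1 ⟨rfl, h⟩
    rw [HH_lie_right hX hkl hjl.symm hij]
    simp [wt, hkl, hij.symm, hjl]
  by_cases hil : i = l
  · subst hil
    have hjk : j ≠ k := fun h => h2 ⟨rfl, h⟩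
    rw [HH_lie_left hX hkl.symm hjk.symm hij]
    simp [wt, hkl.symm, hij.symm, hjk, sub_eq_add_neg]
  by_cases hjk : j = k
  · subst hjk
    rw [HH_swap, neg_mul, HH_lie_right hX hkl (Ne.symm hil) hij.symm]
    simp [wt, hkl, hij, hil]
    abel
  by_cases hjl : j = l
  · subst hjl
    rw [HH_swap, neg_mul, HH_lie_left hX hkl.symm (Ne.symm hik) hij.symm]
    simp [wt, hkl.symm, hij, hik]
    abel
  have c1 : Commute (X i j) (X k l) := hX.comm _ _ _ _ hij hkl hjk hil
  have c2 : Commute (X j i) (X k l) := hX.comm _ _ _ _ hij.symm hkl hik hjl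
  have : Commute (HH X i j) (X k l) := (c1.mul_left c2).sub_left (c2.mul_left c1)
  rw [this.eq]
  simp [wt, hik, hil, hjk, hjl]

lemma HH_weight (h3 : ∀ i j : ι, ∃ k, k ≠ i ∧ k ≠ j) (hX : Stein X) (i j : ι) {k l : ι}
    (hkl : k ≠ l) :
    HH X i j * X k l = X k l * HH X i j + wt i j k l • X k l := by
  by_cases hij : i = j
  · subst hij
    simp [HH_self, wt]
    
  by_cases h : (i = k ∧ j = l) ∨ (i = l ∧ j = k)
  · obtain ⟨m, hmi, hmj⟩ := h3 i j
    rw [← HH_add hX hmi.symm hmj hij, add_mul, mul_add]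
    rw [HH_weight_aux hX hmi.symm hkl (by grind) (by grind),
      HH_weight_aux hX hmj hkl (by grind) (by grind)]
    have : wt i j k l = wt i m k l + wt m j k l := by simp only [wt]; ring
    rw [this, add_smul]
    abel
  · push Not at h
    exact HH_weight_aux hX hij hkl (by grind) (by grind)

lemma HH_cocycle (hX : Stein X) (i j k : ι) : HH X i k - HH X j k = HH X i j := by
  by_cases hij : i = j
  · subst hij; simp [HH_self]
  by_cases hjk : j = k
  · subst hjk; simp [HH_self]
  by_cases hik : i = k
  · subst hik; rw [HH_swap i j]; simp [HH_self]
  rw [← HH_add hX hij hjk hik]; abel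

end

section Casimir
variable {ι R : Type*} [Ring R] [Fintype ι] [DecidableEq ι] (K : Type*) [Field K] [CharZero K]
  [Algebra K R] {X : ι → ι → R} 

/-- traceless diagonal elements -/
noncomputable def DD (X : ι → ι → R) (i : ι) : R := (Fintype.card ι : K)⁻¹ • ∑ j, HH X i j

/-- the full family of elementary elements -/
noncomputable def EE (X : ι → ι → R) (i j : ι) : R := if i = j then DD K X i else X i j

/-- the Casimir element -/
noncomputable def Cas (X : ι → ι → R) : R := ∑ i, ∑ j, EE K X i j * EE K X j i

variable {K} 

lemma DD_sub (hX : Stein X) (i j : ι) : DD K X i - DD K X j = HH X i j := by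
  have : Nonempty ι := ⟨i⟩
  have hc : (Fintype.card ι : K) ≠ 0 := by simp
  rw [DD, DD, ← smul_sub, ← sum_sub_distrib]
  simp only [HH_cocycle hX, sum_const, card_univ]
  rw [← Nat.cast_smul_eq_nsmul K, smul_smul, inv_mul_cancel₀ hc, one_smul]

lemma DD_sum : ∑ i, DD K X i = 0 := by
  simp only [DD]
  rw [← smul_sum]
  have : ∑ i, ∑ j, HH X i j = 0 := by
    simp only [HH, sum_sub_distrib]
    rw [sub_eq_zero, sum_comm]
  rw [this, smul_zero]

lemma DD_weight (h3 : ∀ i j : ι, ∃ k, k ≠ i ∧ k ≠ j) (hX : Stein X) (i : ι) {k l : ι}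
    (hkl : k ≠ l) :
    DD K X i * X k l = X k l * DD K X i + 
      ((if i = k then 1 else 0) - (if i = l then 1 else 0) : ℤ) • X k l := by
  have : Nonempty ι := ⟨i⟩
  have hc : (Fintype.card ι : K) ≠ 0 := by simp
  have e : ∑ j, wt i j k l = (Fintype.card ι : ℤ) * ((if i = k then 1 else 0) - (if i = l then 1 else 0) : ℤ) := by
    simp only [wt, sum_add_distrib, sum_sub_distrib]
    simp [mul_sub]
  rw [DD, smul_mul_assoc, mul_smul_comm, sum_mul, mul_sum]
  simp only [HH_weight h3 hX i _ hkl, sum_add_distrib]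
  rw [smul_add, ← sum_smul, e, mul_smul, Nat.cast_smul_eq_nsmul, ← Nat.cast_smul_eq_nsmul K,
    smul_smul, inv_mul_cancel₀ hc, one_smul]

lemma DD_comm (h3 : ∀ i j : ι, ∃ k, k ≠ i ∧ k ≠ j) (hX : Stein X) (i j : ι) :
    Commute (DD K X i) (DD K X j) := by
  have key : ∀ k l, Commute (DD K X i) (HH X k l) := by
    intro k l
    by_cases hkl : k = l
    · subst hkl; rw [HH_self]; exact Commute.zero_right _
    have : ∀ k l, k ≠ l → Commute (DD K X i) (X k l * X l k) := by
      intro k l hkl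
      rw [commute_iff_eq, ← mul_assoc, DD_weight h3 hX i hkl, add_mul, mul_assoc,
        DD_weight h3 hX i hkl.symm, mul_add, mul_assoc, add_assoc, mul_smul_comm, smul_mul_assoc,
        ← add_smul]
      simp
    exact (this k l hkl).sub_right (this l k (Ne.symm hkl))
  nth_rw 2 [DD]
  exact (Commute.sum_right _ _ _ fun k _ => key j k).smul_right _

lemma EE_rel (h3 : ∀ i j : ι, ∃ k, k ≠ i ∧ k ≠ j) (hX : Stein X) : GlRel (EE K X) := by
  intro i j k l
  by_cases hij : i = j
  · subst hij
    by_cases hkl : k = l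
    · subst hkl
      simp only [EE, if_true]
      rw [(DD_comm h3 hX i k).eq]
      by_cases hik : i = k
      · subst hik; simp
      · simp [hik]
    · simp only [EE, if_true, hkl, if_false]
      rw [DD_weight h3 hX i hkl]
      by_cases hik : i = k
      · subst hik; simp [hkl]
      by_cases hil : i = l
      · subst hil; simp [hik, hkl, sub_eq_add_neg]
      simp [hik, hil]
  by_cases hkl : k = l
  · subst hkl
    simp only [EE, if_true, hij, if_false]
    rw [DD_weight h3 hX k hij]
    by_cases hik : i = k
    · subst hik; simp [hij, Ne.symm hij]
    by_cases hjk : j = k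
    · subst hjk; simp [hij, Ne.symm hij]
    simp [hik, hjk, Ne.symm hik, Ne.symm hjk]
  simp only [EE, hij, hkl, if_false]
  by_cases hjk : j = k
  · subst hjk
    by_cases hil : i = l
    · subst hil
      have := DD_sub (K := K) hX i j
      simp only [if_true]
      rw [add_sub_assoc, this, HH]; abel
    · simp [hil, hX.lie i j l hij hkl hil]
  · by_cases hil : i = l
    · subst hil
      have := hX.lie k i j hkl hij (Ne.symm hjk)
      simp only [hjk, if_true, if_false, Ne.symm hjk]
      rw [this]; abel
    · simp [hil, hjk, (hX.comm i j k l hij hkl hjk hil).eq]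

lemma cas_comm_EE (hE : GlRel (EE K X)) (k l : ι) : Commute (Cas K X) (EE K X k l) := by
  rw [commute_iff_eq, ← sub_eq_zero, Cas]
  simp only [sum_mul, mul_sum, ← sum_sub_distrib]
  have : ∀ i j, EE K X i j * EE K X j i * EE K X k l - EE K X k l * (EE K X i j * EE K X j i) = 
     EE K X i j * ((if i = k then EE K X j l else 0) - (if j = l then EE K X k i else 0))
     + ((if j = k then EE K X i l else 0) - (if i = l then EE K X k j else 0)) * EE K X j i := by
    intro i j
    rw [mul_assoc, hE j i k l, add_sub_assoc, mul_add, ← mul_assoc, hE i j k l]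
    noncomm_ring
  simp only [this, mul_sub, sub_mul, mul_ite, ite_mul, mul_zero, zero_mul, sum_add_distrib,
    sum_sub_distrib, sum_ite_eq', mem_univ, if_true, sum_ite_irrel, sum_const_zero]
  abel

lemma cas_comm (h3 : ∀ i j : ι, ∃ k, k ≠ i ∧ k ≠ j) (hX : Stein X) {k l : ι} (hkl : k ≠ l) :
    Commute (Cas K X) (X k l) := by
  have := cas_comm_EE (EE_rel (K := K) h3 hX) k l
  simpa [EE, hkl] using this

lemma comm_cas {s : R} (hs : ∀ i j, i ≠ j → Commute s (X i j)) : Commute s (Cas K X) := by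
  have h1 : ∀ i j, Commute s (HH X i j) := by
    intro i j
    by_cases hij : i = j
    · subst hij; rw [HH_self]; exact Commute.zero_right _
    have a := hs i j hij
    have b := hs j i (Ne.symm hij)
    exact (a.mul_right b).sub_right (b.mul_right a)
  have h2 : ∀ i j, Commute s (EE K X i j) := by
    intro i j
    simp only [EE]
    split_ifs with h
    · exact (Commute.sum_right _ _ _ fun k _ => h1 i k).smul_right _
    · exact hs i j h
  exact Commute.sum_right _ _ _ fun i _ => Commute.sum_right _ _ _ fun j _ =>
    (h2 i j).mul_right (h2 j i)

end Casimir


section Trace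
variable {K V : Type*} [Field K] [CharZero K] [IsAlgClosed K] [AddCommGroup V] [Module K V]
  [FiniteDimensional K V]

attribute [local instance] LieRing.ofAssociativeRing

lemma sl2_eigenvalue_int {h e f : Module.End K V} (hef : e * f - f * e = h)
    (hhe : h * e = e * h + (2 : ℤ) • e) (hhf : h * f = f * h - (2 : ℤ) • f) (he : IsNilpotent e)
    {μ : K} (hμ : h.HasEigenvalue μ) : ∃ z : ℤ, μ = z := by
  obtain ⟨v, hv⟩ := hμ.exists_hasEigenvector
  by_cases h0 : h = 0
  · subst h0
    refine ⟨0, ?_⟩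
    have := hv.apply_eq_smul
    simp only [LinearMap.zero_apply] at this
    simpa [hv.2] using this.symm
  have ht : IsSl2Triple h e f := by
    refine ⟨h0, ?_, ?_, ?_⟩
    · rw [Ring.lie_def, hef]
    · rw [Ring.lie_def, hhe, add_sub_cancel_left]; norm_cast
    · rw [Ring.lie_def, hhf, sub_sub_cancel_left]; norm_cast
  obtain ⟨d, hd⟩ := he
  have hex : ∃ k, (e ^ k) v = 0 := ⟨d, by simp [hd]⟩
  obtain ⟨k, hk1, hk2⟩ := Nat.exists_not_and_succ_of_not_zero_of_exists
    (p := fun k => (e ^ k) v = 0) (by simpa using hv.2) hex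
  have hw : ∀ k : ℕ, h ((e ^ k) v) = (μ + 2 * k) • (e ^ k) v := by
    intro k
    induction k with
    | zero => simpa using hv.apply_eq_smul
    | succ k ih =>
      rw [pow_succ', Module.End.mul_apply, ← Module.End.mul_apply h e, hhe, LinearMap.add_apply,
        Module.End.mul_apply, ih, map_smul, LinearMap.smul_apply, ← Int.cast_smul_eq_zsmul K,
        ← add_smul]
      congr 1
      push_cast
      ring
  have hp : ht.HasPrimitiveVectorWith ((e ^ k) v) (μ + 2 * k) :=
    ⟨hk1, hw k, by
      have : e ((e ^ k) v) = 0 := by rw [← Module.End.mul_apply, ← pow_succ']; exact hk2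
      exact this⟩
  obtain ⟨m, hm⟩ := hp.exists_nat
  refine ⟨m - 2 * k, ?_⟩
  push_cast
  rw [← hm]; ring

lemma trace_sq {h : Module.End K V} (hz : ∀ μ : K, h.HasEigenvalue μ → ∃ z : ℤ, μ = z) :
    ∃ m : ℕ, LinearMap.trace K V (h * h) = m ∧ (m = 0 → IsNilpotent h) := by
  classical
  have hsup := Module.End.iSup_maxGenEigenspace_eq_top h
  have hds := DirectSum.isInternal_submodule_of_iSupIndep_of_iSup_eq_top
      h.independent_maxGenEigenspace hsup
  have h_fin : {μ | h.maxGenEigenspace μ ≠ ⊥}.Finite :=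
      WellFoundedGT.finite_ne_bot_of_iSupIndep h.independent_maxGenEigenspace
  have hh : ∀ μ, Set.MapsTo h (h.maxGenEigenspace μ) (h.maxGenEigenspace μ) :=
    fun μ => h.mapsTo_maxGenEigenspace_of_comm rfl μ
  have hhh : ∀ μ, Set.MapsTo (h ∘ₗ h) (h.maxGenEigenspace μ) (h.maxGenEigenspace μ) :=
    fun μ => (hh μ).comp (hh μ)
  have htr := LinearMap.trace_eq_sum_trace_restrict' hds h_fin hhh
  have hloc : ∀ μ, LinearMap.trace K _ ((h ∘ₗ h).restrict (hhh μ)) =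
      μ * (μ * Module.finrank K (h.maxGenEigenspace μ)) := by
    intro μ
    have hn := h.isNilpotent_restrict_maxGenEigenspace_sub_algebraMap μ
    rw [LinearMap.restrict_comp (hh μ) (hh μ),
      LinearMap.trace_comp_eq_mul_of_commute_of_isNilpotent μ (Commute.refl _) hn]
    have := LinearMap.trace_comp_eq_mul_of_commute_of_isNilpotent (f := LinearMap.id) μ
      (Commute.one_left (h.restrict (hh μ))) hn
    rw [LinearMap.id_comp, LinearMap.trace_id] at this
    rw [this]
  have hz' : ∀ μ : K, ∃ z : ℤ, h.maxGenEigenspace μ ≠ ⊥ → μ = z := by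
    intro μ
    by_cases hb : h.maxGenEigenspace μ = ⊥
    · exact ⟨0, fun h => absurd hb h⟩
    · obtain ⟨z, h'⟩ := hz μ (by
        have hb' : h.HasUnifEigenvalue μ ⊤ := hb
        exact hb'.lt zero_lt_one)
      exact ⟨z, fun _ => h'⟩
  choose z hz' using hz'
  refine ⟨∑ μ ∈ h_fin.toFinset, (z μ).natAbs ^ 2 * Module.finrank K (h.maxGenEigenspace μ), ?_, ?_⟩
  · rw [Module.End.mul_eq_comp, htr]
    push_cast
    refine sum_congr rfl fun μ hμ => ?_
    have hμ' := hz' μ (by simpa using hμ)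
    rw [hloc]
    have e : (((z μ).natAbs : K)) ^ 2 = μ ^ 2 := by
      have e1 := congrArg (Int.cast (R := K)) (Int.natAbs_sq (z μ))
      rw [Int.cast_pow, Int.cast_pow, ← hμ'] at e1
      rw [← e1, Int.cast_natCast]
    rw [e]; ring
  · intro h0
    rw [sum_eq_zero_iff] at h0
    have h1 : ∀ μ, μ ≠ 0 → h.maxGenEigenspace μ = ⊥ := by
      intro μ hμ
      by_contra hb
      have := h0 μ (by simpa using hb)
      rw [mul_eq_zero] at this
      rcases this with h | h
      · have hz0 : z μ = 0 := by simpa using h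
        apply hμ
        rw [hz' μ hb, hz0]; simp
      · exact hb (Submodule.finrank_eq_zero.mp h)
    have h2 : h.maxGenEigenspace 0 = ⊤ := by
      rw [eq_top_iff, ← hsup]
      refine iSup_le fun μ => ?_
      by_cases hμ : μ = 0
      · rw [hμ]
      · rw [h1 μ hμ]; exact bot_le
    refine ⟨Module.finrank K V, ?_⟩
    ext v
    have : v ∈ h.maxGenEigenspace 0 := h2 ▸ Submodule.mem_top
    rw [Module.End.maxGenEigenspace_eq_genEigenspace_finrank, Module.End.mem_genEigenspace_nat] at this
    simpa using this

lemma eq_zero_of_weight_two {h e : Module.End K V} (hhe : h * e = e * h + (2 : ℤ) • e)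
    (hn : IsNilpotent h) : e = 0 := by
  have h1 : h * e = e * (h + 2) := by
    rw [hhe, mul_add]; congr 1
    rw [mul_two, two_smul]
  obtain ⟨d, hd⟩ := hn
  have h2 := pow_intertwine h1 d
  rw [hd, zero_mul] at h2
  have hu : IsUnit (h + 2) := by
    have : IsUnit (2 : Module.End K V) := by
      have : (2 : Module.End K V) = algebraMap K _ 2 := (map_ofNat _ 2).symm
      rw [this]
      exact (IsUnit.mk0 (2:K) two_ne_zero).map _
    exact IsNilpotent.isUnit_add_right_of_commute ⟨d, hd⟩ this (Commute.ofNat_right _ _)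
  exact ((hu.pow d).mul_left_eq_zero).mp h2.symm

lemma trivial_of_cas_nilpotent {ι : Type*} [Fintype ι] [DecidableEq ι] {X : ι → ι → Module.End K V}
    (h3 : ∀ i j : ι, ∃ k, k ≠ i ∧ k ≠ j) (hX : Stein X) (hnil : ∀ i j, i ≠ j → IsNilpotent (X i j))
    (hC : IsNilpotent (Cas K X)) {i j : ι} (hij : i ≠ j) : X i j = 0 := by
  have htwo : ∀ i j, i ≠ j → HH X i j * X i j = X i j * HH X i j + (2 : ℤ) • X i j := by
    intro i j hij
    have := HH_weight h3 hX i j hij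
    simpa [wt, hij, hij.symm] using this
  have htwo' : ∀ i j, i ≠ j → HH X i j * X j i = X j i * HH X i j - (2 : ℤ) • X j i := by
    intro i j hij
    have := HH_weight h3 hX i j hij.symm
    simpa [wt, hij, hij.symm, sub_eq_add_neg] using this
  have hm : ∀ i j, ∃ m : ℕ, LinearMap.trace K V (HH X i j * HH X i j) = m ∧
      (m = 0 → IsNilpotent (HH X i j)) := by
    intro i j
    by_cases hij : i = j
    · subst hij
      exact ⟨0, by simp [HH_self]⟩
    exact trace_sq fun μ hμ => sl2_eigenvalue_int rfl (htwo i j hij) (htwo' i j hij)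
      (hnil i j hij) hμ
  choose m hm1 hm2 using hm
  set tr := LinearMap.trace K V with htr
  have hne : Nonempty ι := ⟨i⟩
  have hc : (Fintype.card ι : K) ≠ 0 := by simp
  have t1 : ∀ i j, i ≠ j → tr (X i j * X j i) = m i j / 2 := by
    intro i j hij
    rw [eq_div_iff two_ne_zero, ← hm1]
    have e2 : (2:ℤ) • X i j = HH X i j * X i j - X i j * HH X i j := by
      rw [htwo i j hij]; abel
    have : tr (((2:ℤ) • X i j) * X j i) = tr (HH X i j * HH X i j) := by
      rw [e2, sub_mul, map_sub, mul_assoc, mul_assoc (X i j), LinearMap.trace_mul_comm K (X i j),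
        ← map_sub, mul_assoc, ← mul_sub]
      rfl
    rw [← this, smul_mul_assoc, map_zsmul]
    simp; ring
  have t2 : ∑ i, ∑ j, (m i j : K) = 2 * Fintype.card ι * ∑ i, tr (DD K X i * DD K X i) := by
    have : ∀ i j, (m i j : K) = tr (DD K X i * DD K X i) + tr (DD K X j * DD K X j) -
        2 * tr (DD K X i * DD K X j) := by
      intro i j
      rw [← hm1, ← DD_sub (K := K) hX i j, sub_mul, mul_sub, mul_sub, map_sub, map_sub, map_sub,
        LinearMap.trace_mul_comm K (DD K X j) (DD K X i)]
      ring
    have hz : ∀ i, ∑ j, tr (DD K X i * DD K X j) = 0 := by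
      intro i
      rw [← map_sum, ← mul_sum, DD_sum, mul_zero, map_zero]
    generalize tr = t at *
    simp only [this, sum_sub_distrib, sum_add_distrib, ← mul_sum, hz, sum_const, card_univ,
      nsmul_eq_mul]
    ring
  have t3 : tr (Cas K X) = ∑ i, tr (DD K X i * DD K X i) + (∑ i, ∑ j, (m i j : K)) / 2 := by
    rw [Cas, map_sum, sum_div, ← sum_add_distrib]
    refine sum_congr rfl fun i _ => ?_
    rw [map_sum, sum_div, ← add_sum_erase univ _ (mem_univ i),
      ← add_sum_erase univ (fun j => (m i j : K) / 2) (mem_univ i)]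
    have h0 : (m i i : K) = 0 := by rw [← hm1, HH_self]; simp
    rw [h0, zero_div, zero_add]
    congr 1
    · simp [EE]
    · refine sum_congr rfl fun j hj => ?_
      have hij : j ≠ i := ne_of_mem_erase hj
      rw [← t1 i j hij.symm]
      simp [EE, hij, hij.symm]
  have t4 : tr (Cas K X) = 0 := (LinearMap.isNilpotent_trace_of_isNilpotent hC).eq_zero
  have t5 : ((∑ i, ∑ j, m i j : ℕ) : K) * (1 + Fintype.card ι : ℕ) = 0 := by
    push_cast
    have : ∑ i, tr (DD K X i * DD K X i) = - (∑ i, ∑ j, (m i j : K)) / 2 := by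
      rw [t4] at t3
      linear_combination -t3
    rw [this] at t2
    linear_combination t2
  have t6 : ∑ i, ∑ j, m i j = 0 := by
    have : (∑ i, ∑ j, m i j) * (1 + Fintype.card ι) = 0 := by exact_mod_cast t5
    rcases Nat.mul_eq_zero.mp this with h | h
    · exact h
    · omega
  have t7 : m i j = 0 := by
    rw [sum_eq_zero_iff] at t6
    have := t6 i (mem_univ _)
    rw [sum_eq_zero_iff] at this
    exact this j (mem_univ _)
  exact eq_zero_of_weight_two (htwo i j hij) (hm2 i j t7)

end Trace


/-! ### Part 4: elementary matrices over the integers -/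

section Elem
open Matrix
variable {ι : Type*} [Fintype ι] [DecidableEq ι]

/-- kill the `l`-th coordinate -/
def off (l : ι) (v : ι → ℤ) : ι → ℤ := fun i => if i = l then 0 else v i

lemma off_add (l : ι) (v w : ι → ℤ) : off l (v + w) = off l v + off l w := by
  ext i; simp only [off, Pi.add_apply]; split_ifs <;> simp

lemma off_self (l : ι) (v : ι → ℤ) : off l v l = 0 := by simp [off]
lemma off_ne {l i : ι} (h : i ≠ l) (v : ι → ℤ) : off l v i = v i := by simp [off, h]

/-- column operation matrix -/
def Umat (l : ι) (v : ι → ℤ) : Matrix ι ι ℤ := 1 + vecMulVec (off l v) (Pi.single l 1)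
/-- row operation matrix -/
def Rmat (l : ι) (v : ι → ℤ) : Matrix ι ι ℤ := 1 + vecMulVec (Pi.single l 1) (off l v)

lemma Umat_add (l : ι) (v w : ι → ℤ) : Umat l (v + w) = Umat l v * Umat l w := by
  simp only [Umat, off_add, add_mul, mul_add, one_mul, mul_one, vecMulVec_mul_vecMulVec,
    add_vecMulVec]
  simp [off_self]
  abel

lemma Rmat_add (l : ι) (v w : ι → ℤ) : Rmat l (v + w) = Rmat l v * Rmat l w := by
  simp only [Rmat, off_add, add_mul, mul_add, one_mul, mul_one, vecMulVec_mul_vecMulVec,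
    vecMulVec_add]
  simp [off_self]
  abel

lemma Umat_zero (l : ι) : Umat l 0 = 1 := by
  have : off l 0 = 0 := by ext i; simp [off]
  simp [Umat, this]

lemma Rmat_zero (l : ι) : Rmat l 0 = 1 := by
  have : off l 0 = 0 := by ext i; simp [off]
  simp [Rmat, this]

/-- column operations -/
def U (l : ι) : Multiplicative (ι → ℤ) →* GL ι ℤ where
  toFun v := ⟨Umat l v.toAdd, Umat l (-v.toAdd), by rw [← Umat_add]; simp [Umat_zero],
    by rw [← Umat_add]; simp [Umat_zero]⟩
  map_one' := by ext1; exact Umat_zero l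
  map_mul' v w := by ext1; exact Umat_add l _ _

/-- row operations -/
def R (l : ι) : Multiplicative (ι → ℤ) →* GL ι ℤ where
  toFun v := ⟨Rmat l v.toAdd, Rmat l (-v.toAdd), by rw [← Rmat_add]; simp [Rmat_zero],
    by rw [← Rmat_add]; simp [Rmat_zero]⟩
  map_one' := by ext1; exact Rmat_zero l
  map_mul' v w := by ext1; exact Rmat_add l _ _

lemma U_mul_apply (l : ι) (v : ι → ℤ) (g : Matrix ι ι ℤ) (i j : ι) :
    (Umat l v * g) i j = g i j + off l v i * g l j := by
  simp [Umat, add_mul, vecMulVec_mul, vecMulVec_apply]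

lemma R_mul_apply (l : ι) (v : ι → ℤ) (g : Matrix ι ι ℤ) (i j : ι) :
    (Rmat l v * g) i j = g i j + if i = l then ∑ k, off l v k * g k j else 0 := by
  simp [Rmat, add_mul, vecMulVec_mul, vecMulVec_apply, vecMul, dotProduct, Pi.single_apply]

lemma mul_R_apply (l : ι) (v : ι → ℤ) (g : Matrix ι ι ℤ) (i j : ι) :
    (g * Rmat l v) i j = g i j + g i l * off l v j := by
  simp [Rmat, mul_add, mul_vecMulVec, vecMulVec_apply]

/-- the elementary matrices -/
def x (i j : ι) (c : ℤ) : GL ι ℤ := U j (Multiplicative.ofAdd (Pi.single i c))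

lemma x_val {i j : ι} (h : i ≠ j) (c : ℤ) : (x i j c : Matrix ι ι ℤ) = 1 + Matrix.single i j c := by
  change Umat j (Pi.single i c) = _
  ext a b
  by_cases ha : a = j <;> by_cases hb : b = j <;> by_cases hi : a = i <;>
    simp_all [Umat, vecMulVec_apply, off, Matrix.single_apply, Pi.single_apply] <;> grind

lemma R_val {i j : ι} (h : i ≠ j) (c : ℤ) : R i (Multiplicative.ofAdd (Pi.single j c)) = x i j c := by
  ext1
  rw [x_val h]
  change Rmat i (Pi.single j c) = _
  ext a b
  by_cases ha : a = j <;> by_cases hb : b = j <;> by_cases hi : a = i <;>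
    simp_all [Rmat, vecMulVec_apply, off, Matrix.single_apply, Pi.single_apply] <;> grind

lemma x_add (i j : ι) (c d : ℤ) : x i j (c + d) = x i j c * x i j d := by
  rw [x, x, x, ← map_mul, Pi.single_add, ofAdd_add]

lemma x_zpow (i j : ι) (c d : ℤ) : x i j c ^ d = x i j (d * c) := by
  rw [x, x, ← map_zpow, ← ofAdd_zsmul, ← Pi.single_smul, smul_eq_mul]

lemma x_pow (i j : ι) (c : ℤ) (m : ℕ) : x i j c ^ m = x i j (m * c) := by
  rw [← zpow_natCast, x_zpow]

lemma x_comm {i j k l : ι} (hij : i ≠ j) (hkl : k ≠ l) (hjk : j ≠ k) (hil : i ≠ l) (c d : ℤ) :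
    Commute (x i j c) (x k l d) := by
  ext1
  rw [Units.val_mul, Units.val_mul, x_val hij, x_val hkl]
  simp [add_mul, mul_add, hjk, hil.symm]
  abel

lemma x_lie {i j k : ι} (hij : i ≠ j) (hjk : j ≠ k) (hik : i ≠ k) (c d : ℤ) :
    x i j c * x j k d = x i k (c * d) * x j k d * x i j c := by
  ext1
  simp only [Units.val_mul, x_val hij, x_val hjk, x_val hik]
  simp [add_mul, mul_add, hjk.symm, hik.symm, hij.symm]
  abel

/-- the elementary group -/
def EG (ι : Type*) [Fintype ι] [DecidableEq ι] : Subgroup (GL ι ℤ) :=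
  Subgroup.closure {g | ∃ i j, i ≠ j ∧ g = x i j 1}

lemma x_mem {i j : ι} (h : i ≠ j) (c : ℤ) : x i j c ∈ EG ι := by
  have := (EG ι).zpow_mem (Subgroup.subset_closure ⟨i, j, h, rfl⟩ : x i j 1 ∈ EG ι) c
  rwa [x_zpow, mul_one] at this

lemma ofAdd_eq_prod (v : ι → ℤ) :
    Multiplicative.ofAdd v = ∏ i, Multiplicative.ofAdd (Pi.single i (v i)) := by
  rw [← ofAdd_sum, Finset.univ_sum_single]

lemma x_self (i : ι) (c : ℤ) : x i i c = 1 := by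
  ext1
  change Umat i (Pi.single i c) = 1
  have : off i (Pi.single i c) = 0 := by
    ext k; simp only [off, Pi.single_apply, Pi.zero_apply]; grind
  simp [Umat, this]

lemma R_self (i : ι) (c : ℤ) : R i (Multiplicative.ofAdd (Pi.single i c)) = 1 := by
  ext1
  change Rmat i (Pi.single i c) = 1
  have : off i (Pi.single i c) = 0 := by
    ext k; simp only [off, Pi.single_apply, Pi.zero_apply]; grind
  simp [Rmat, this]

lemma U_mem (l : ι) (v : Multiplicative (ι → ℤ)) : U l v ∈ EG ι := by
  suffices v ∈ (EG ι).comap (U l) from this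
  have : v = Multiplicative.ofAdd v.toAdd := rfl
  rw [this, ofAdd_eq_prod]
  refine Subgroup.prod_mem _ fun i _ => ?_
  rw [Subgroup.mem_comap]
  by_cases h : i = l
  · subst h
    have := x_self i (v.toAdd i)
    rw [x] at this
    rw [this]; exact one_mem _
  · exact x_mem h _

lemma R_mem (l : ι) (v : Multiplicative (ι → ℤ)) : R l v ∈ EG ι := by
  suffices v ∈ (EG ι).comap (R l) from this
  have : v = Multiplicative.ofAdd v.toAdd := rfl
  rw [this, ofAdd_eq_prod]
  refine Subgroup.prod_mem _ fun i _ => ?_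
  rw [Subgroup.mem_comap]
  by_cases h : i = l
  · subst h
    rw [R_self]; exact one_mem _
  · rw [R_val (Ne.symm h)]; exact x_mem (Ne.symm h) _

/-- Every invertible integer matrix can be row-reduced to a matrix with small entries. -/
lemma gen_aux (J : Finset ι) (c : ι) (hc : c ∉ J) : ∀ (m : ℕ) (g : GL ι ℤ),
    (∀ j ∈ J, ∃ i, (∀ k, k ≠ i → g.1 k j = 0) ∧ IsUnit (g.1 i j)) →
    (∑ i, if ∀ j ∈ J, g.1 i j = 0 then (g.1 i c).natAbs else 0) = m →
    ∃ e ∈ EG ι, ∀ j ∈ insert c J, ∃ i, (∀ k, k ≠ i → (e * g).1 k j = 0) ∧ IsUnit ((e * g).1 i j) := by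
  intro m
  induction m using Nat.strong_induction_on with
  | _ m ih =>
  intro g hg hm
  by_cases hE : ∃ i k, i ≠ k ∧ (∀ j ∈ J, g.1 i j = 0) ∧ (∀ j ∈ J, g.1 k j = 0) ∧
      g.1 i c ≠ 0 ∧ (g.1 i c).natAbs ≤ (g.1 k c).natAbs
  · obtain ⟨i, k, hik, hi, hk, hi0, hle⟩ := hE
    set q := g.1 k c / g.1 i c
    set e := U i (Multiplicative.ofAdd (Pi.single k (-q))) with he
    have hent : ∀ a b, (e * g).1 a b = g.1 a b + (if a = k then -q * g.1 i b else 0) := by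
      intro a b
      change (Umat i (Pi.single k (-q)) * g.1) a b = _
      rw [U_mul_apply]
      congr 1
      simp only [off, Pi.single_apply]
      grind
    have hJ : ∀ a, ∀ b ∈ J, (e * g).1 a b = g.1 a b := by
      intro a b hb
      rw [hent, hi b hb]; simp
    have hlt : (∑ a, if ∀ j ∈ J, (e * g).1 a j = 0 then ((e * g).1 a c).natAbs else 0) < m := by
      rw [← hm]
      have hmod : (g.1 k c + -q * g.1 i c) = g.1 k c % g.1 i c := by
        rw [Int.emod_def]; ring
      have hlt' : (g.1 k c + -q * g.1 i c).natAbs < (g.1 k c).natAbs := by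
        rw [hmod]
        have h1 := Int.emod_lt_abs (g.1 k c) hi0
        have h2 := Int.emod_nonneg (g.1 k c) hi0
        rw [Int.abs_eq_natAbs] at h1
        generalize g.1 k c % g.1 i c = r at h1 h2
        omega
      refine Finset.sum_lt_sum (fun a _ => ?_) ⟨k, mem_univ _, ?_⟩
      · have : (∀ j ∈ J, (e * g).1 a j = 0) ↔ (∀ j ∈ J, g.1 a j = 0) :=
          forall₂_congr fun b hb => by rw [hJ a b hb]
        simp only [this]
        split_ifs
        · rw [hent]
          split_ifs with hak
          · subst hak; exact hlt'.le
          · simp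
        · exact le_rfl
      · rw [if_pos, if_pos hk, hent, if_pos rfl]
        · exact hlt'
        · intro b hb; rw [hJ k b hb, hk b hb]
    obtain ⟨e', he', h'⟩ := ih _ hlt (e * g) (by
      intro j hj
      obtain ⟨i, h1, h2⟩ := hg j hj
      exact ⟨i, fun k hk => by rw [hJ k j hj, h1 k hk], by rwa [hJ i j hj]⟩) rfl
    exact ⟨e' * e, mul_mem he' (U_mem _ _), by rwa [mul_assoc]⟩
  · push Not at hE
    have hinv : ∀ j, ∑ i, (g⁻¹).1 c i * g.1 i j = if c = j then 1 else 0 := by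
      intro j
      have : (g⁻¹).1 * g.1 = 1 := by rw [← Units.val_mul]; simp
      have := congrFun (congrFun this c) j
      rwa [Matrix.mul_apply, Matrix.one_apply] at this
    have hz : ∀ i, (¬ ∀ j ∈ J, g.1 i j = 0) → (g⁻¹).1 c i = 0 := by
      intro i hi
      push Not at hi
      obtain ⟨j, hj, hij⟩ := hi
      obtain ⟨a, h1, h2⟩ := hg j hj
      have hai : i = a := by by_contra h; exact hij (h1 i h)
      subst hai
      have := hinv j
      rw [Finset.sum_eq_single i (fun b _ hb => by rw [h1 b hb, mul_zero]) (by simp),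
        if_neg (by rintro rfl; exact hc hj)] at this
      exact (mul_eq_zero.mp this).resolve_right hij
    have hex : ∃ i, (∀ j ∈ J, g.1 i j = 0) ∧ g.1 i c ≠ 0 := by
      by_contra hno
      push Not at hno
      have := hinv c
      rw [if_pos rfl, Finset.sum_eq_zero] at this
      · exact zero_ne_one this
      · intro i _
        by_cases h : ∀ j ∈ J, g.1 i j = 0
        · rw [hno i h, mul_zero]
        · rw [hz i h, zero_mul]
    obtain ⟨i, hi, hi0⟩ := hex
    have huniq : ∀ k, k ≠ i → (∀ j ∈ J, g.1 k j = 0) → g.1 k c = 0 := by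
      intro k hk hkJ
      by_contra hk0
      have h1 := hE i k hk.symm hi hkJ hi0
      have h2 := hE k i hk hkJ hi hk0
      omega
    have hu : (g⁻¹).1 c i * g.1 i c = 1 := by
      have := hinv c
      rw [if_pos rfl, Finset.sum_eq_single i (fun b _ hb => ?_) (by simp)] at this
      · exact this
      · by_cases h : ∀ j ∈ J, g.1 b j = 0
        · rw [huniq b hb h, mul_zero]
        · rw [hz b h, zero_mul]
    set v : ι → ℤ := fun k => - (g.1 k c * (g⁻¹).1 c i)
    have hent : ∀ a b, (U i (Multiplicative.ofAdd v) * g).1 a b = g.1 a b + off i v a * g.1 i b :=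
      fun a b => U_mul_apply i v g.1 a b
    refine ⟨U i (Multiplicative.ofAdd v), U_mem _ _, ?_⟩
    intro j hj
    rcases Finset.mem_insert.mp hj with rfl | hj
    · refine ⟨i, ?_, ?_⟩
      · intro k hk
        rw [hent, off_ne hk]
        linear_combination (-g.1 k j) * hu
      · rw [hent, off_self, zero_mul, add_zero]
        exact IsUnit.of_mul_eq_one _ ((mul_comm _ _).trans hu)
    · have hJ : ∀ a, (U i (Multiplicative.ofAdd v) * g).1 a j = g.1 a j := by
        intro a; rw [hent, hi j hj]; simp
      obtain ⟨a, h1, h2⟩ := hg j hj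
      exact ⟨a, fun k hk => by rw [hJ, h1 k hk], by rwa [hJ]⟩

lemma gen (g : GL ι ℤ) : ∃ e ∈ EG ι, ∀ i j, (e * g).1 i j ∈ Set.Icc (-1 : ℤ) 1 := by
  have : ∀ J : Finset ι, ∃ e ∈ EG ι, ∀ j ∈ J, ∃ i, (∀ k, k ≠ i → (e * g).1 k j = 0) ∧
      IsUnit ((e * g).1 i j) := by
    intro J
    induction J using Finset.induction_on with
    | empty => exact ⟨1, one_mem _, by simp⟩
    | insert c J hc ih =>
      obtain ⟨e, he, h⟩ := ih
      obtain ⟨e', he', h'⟩ := gen_aux J c hc _ (e * g) h rfl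
      exact ⟨e' * e, mul_mem he' he, by rwa [mul_assoc]⟩
  obtain ⟨e, he, h⟩ := this univ
  refine ⟨e, he, fun i j => ?_⟩
  obtain ⟨a, h1, h2⟩ := h j (mem_univ _)
  by_cases hia : i = a
  · subst hia
    rcases Int.isUnit_iff.mp h2 with h | h <;> rw [h] <;> simp
  · rw [h1 i hia]; simp

end Elem

/-! ### Part 5: a finiteness theorem for the elementary group -/

section Finiteness
open Matrix

lemma coprime_shift (a b d : ℤ) (hd : d ≠ 0) (h : ∀ p : ℕ, p.Prime → (p : ℤ) ∣ a → (p : ℤ) ∣ b →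
    (p : ℤ) ∣ d → False) : ∃ t : ℤ, IsCoprime (b + t * a) d := by
  classical
  set S : Finset ℕ := d.natAbs.primeFactors.filter (fun p : ℕ => ¬ (p : ℤ) ∣ b) with hS
  refine ⟨∏ p ∈ S, (p : ℤ), ?_⟩
  rw [Int.isCoprime_iff_gcd_eq_one]
  by_contra hg
  obtain ⟨p, hp, hpd⟩ := Nat.exists_prime_and_dvd hg
  have h1 : (p : ℤ) ∣ b + (∏ p ∈ S, (p : ℤ)) * a := (Int.natCast_dvd_natCast.mpr hpd).trans (Int.gcd_dvd_left ..)
  have h2 : (p : ℤ) ∣ d := (Int.natCast_dvd_natCast.mpr hpd).trans (Int.gcd_dvd_right ..)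
  have hpp : Prime (p : ℤ) := Nat.prime_iff_prime_int.mp hp
  by_cases hb : (p : ℤ) ∣ b
  · have h3 := (Int.dvd_add_right hb).mp h1
    rcases hpp.dvd_or_dvd h3 with h4 | h4
    · obtain ⟨q, hq, hpq⟩ := (hpp.dvd_finsetProd_iff _).mp h4
      rw [hS, mem_filter, Nat.mem_primeFactors] at hq
      have : p = q := (Nat.prime_dvd_prime_iff_eq hp hq.1.1).mp (Int.natCast_dvd_natCast.mp hpq)
      subst this
      exact hq.2 hb
    · exact h p hp h4 hb h2
  · apply hb
    have hm : p ∈ S := by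
      rw [hS, mem_filter, Nat.mem_primeFactors]
      exact ⟨⟨hp, Int.natCast_dvd.mp h2, by simpa using hd⟩, hb⟩
    have h5 : (p : ℤ) ∣ ∏ p ∈ S, (p : ℤ) := Finset.dvd_prod_of_mem (fun p : ℕ => (p : ℤ)) hm
    exact (Int.dvd_add_left (h5.mul_right a)).mp h1

variable {ι : Type*} [Fintype ι] [DecidableEq ι]

/-- stable range condition for the integers -/
lemma stable_range (h3 : ∀ i j : ι, ∃ k, k ≠ i ∧ k ≠ j) (l : ι) (a : ℤ) (b h : ι → ℤ)
    (c : ℤ) (hu : ∑ i, off l h i * b i + c * a = 1) :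
    ∃ t s : ι → ℤ, ∑ i, off l s i * (b i + t i * a) = 1 := by
  obtain ⟨p, hpl, -⟩ := h3 l l
  obtain ⟨q, hql, hqp⟩ := h3 l p
  -- the other entries
  set S : Finset ι := univ.filter (fun i => i ≠ l ∧ i ≠ p) with hS
  have hsplit : ∀ f : ι → ℤ, ∑ i, off l f i * b i = f p * b p + ∑ i ∈ S, f i * b i := by
    intro f
    rw [← Finset.add_sum_erase univ _ (mem_univ p), off_ne hpl]
    congr 1
    rw [hS, Finset.sum_filter, ← Finset.add_sum_erase univ _ (mem_univ p)]
    simp only [ne_eq, not_true_eq_false, and_false, if_false, zero_add]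
    refine Finset.sum_congr rfl fun i hi => ?_
    have := ne_of_mem_erase hi
    simp only [off]; grind
  obtain ⟨d, hd⟩ := (inferInstance : (Ideal.span (b '' (S : Set ι))).IsPrincipal)
  have hdvd : ∀ i ∈ S, d ∣ b i := by
    intro i hi
    rw [← Ideal.mem_span_singleton]
    change b i ∈ Submodule.span ℤ {d}
    rw [← hd]
    exact Ideal.subset_span ⟨i, hi, rfl⟩
  have hd' : ∃ s : ι → ℤ, d = ∑ i ∈ S, s i * b i := by
    have : d ∈ Submodule.span ℤ (b '' (S : Set ι)) := by
      change d ∈ Ideal.span _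
      rw [hd]; exact Submodule.mem_span_singleton_self d
    obtain ⟨s, hs⟩ := (Submodule.mem_span_image_finset_iff_exists_fun ℤ).mp this
    refine ⟨fun i => if h : i ∈ S then s ⟨i, h⟩ else 0, ?_⟩
    rw [← hs, ← Finset.sum_coe_sort S]
    exact Finset.sum_congr rfl fun i _ => by simp
  obtain ⟨s, hs⟩ := hd'
  rw [hsplit] at hu
  have hdsum : ∀ f : ι → ℤ, d ∣ ∑ i ∈ S, f i * b i := fun f =>
    Finset.dvd_sum fun i hi => (hdvd i hi).mul_left _
  by_cases hd0 : d = 0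
  · have hb0 : ∀ i ∈ S, b i = 0 := fun i hi => by
      have := hdvd i hi; rwa [hd0, zero_dvd_iff] at this
    have h0 : ∑ i ∈ S, h i * b i = 0 := Finset.sum_eq_zero fun i hi => by rw [hb0 i hi, mul_zero]
    rw [h0] at hu
    refine ⟨Pi.single q 1, Pi.single p (h p) + Pi.single q c, ?_⟩
    have hbq : b q = 0 := hb0 q (by simp [hS, hql, hqp])
    rw [off_add]
    simp only [Pi.add_apply, add_mul, sum_add_distrib]
    rw [Finset.sum_eq_single p, Finset.sum_eq_single q]
    · simp [off_ne hpl, off_ne hql, hqp, hqp.symm, hbq]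
      linarith
    · intro i _ hi; simp [off, hi]
    · simp
    · intro i _ hi; simp [off, hi]
    · simp
  · obtain ⟨t, x, y, hxy⟩ := coprime_shift a (b p) d hd0 (by
      intro r hr h1 h2 h3
      have : (r : ℤ) ∣ 1 := by
        rw [← hu]
        exact dvd_add (dvd_add (h2.mul_left _) (h3.trans (hdsum h))) (h1.mul_left _)
      exact (Nat.prime_iff_prime_int.mp hr).not_isUnit (isUnit_of_dvd_one this))
    refine ⟨Pi.single p t, fun i => if i = p then x else y * s i, ?_⟩
    rw [← hxy]
    simp only [mul_add, sum_add_distrib]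
    have hsingle : ∀ f : ι → ℤ, ∑ i, off l f i * ((Pi.single p t : ι → ℤ) i * a) = f p * (t * a) := by
      intro f
      rw [Finset.sum_eq_single p (fun i _ hi => by simp [hi]) (by simp), off_ne hpl]
      simp
    rw [hsplit, hsingle]
    simp only [if_true, Pi.single_eq_same]
    have : ∑ i ∈ S, (if i = p then x else y * s i) * b i = y * d := by
      rw [hs, mul_sum]
      refine Finset.sum_congr rfl fun i hi => ?_
      have : i ≠ p := by simp [hS] at hi; exact hi.2
      rw [if_neg this]; ring
    rw [this]; ring

variable {Q : Type*} [Group Q] (N : ℕ) [NeZero N]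

/-- column operations in the elementary group -/
def UE (l : ι) : Multiplicative (ι → ℤ) →* EG ι := (U l).codRestrict _ (U_mem l)
/-- row operations in the elementary group -/
def RE (l : ι) : Multiplicative (ι → ℤ) →* EG ι := (R l).codRestrict _ (R_mem l)
/-- elementary matrices in the elementary group -/
def xE {i j : ι} (h : i ≠ j) (c : ℤ) : EG ι := ⟨x i j c, x_mem h c⟩

/-- reduction mod `N` -/
def red (ι : Type*) [Fintype ι] [DecidableEq ι] : EG ι →* Matrix ι ι (ZMod N) :=
  ((Int.castRingHom (ZMod N)).mapMatrix : Matrix ι ι ℤ →+* Matrix ι ι (ZMod N)).toMonoidHom.comp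
    ((Units.coeHom (Matrix ι ι ℤ)).comp (EG ι).subtype)

variable {N}

lemma red_one {g : EG ι} (h : red N ι g = 1) (i j : ι) : ∃ m : ℤ, g.1.1 i j = N * m + (if i = j then 1 else 0) := by
  have := congrFun (congrFun h i) j
  change ((g.1.1 i j : ℤ) : ZMod N) = (1 : Matrix ι ι (ZMod N)) i j at this
  have h2 : ((g.1.1 i j - (if i = j then 1 else 0) : ℤ) : ZMod N) = 0 := by
    push_cast
    rw [this, Matrix.one_apply]; simp
  obtain ⟨m, hm⟩ := (ZMod.intCast_zmod_eq_zero_iff_dvd _ N).mp h2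
  exact ⟨m, by rw [← hm]; ring⟩

section
variable {φ : EG ι →* Q} (hφ : ∀ i j (h : i ≠ j), φ (xE h N) = 1)

lemma split_dvd (v : ι → ℤ) (hv : ∀ i, (N : ℤ) ∣ v i) :
    ∃ c : ι → ℤ, Multiplicative.ofAdd v = ∏ i, (Multiplicative.ofAdd (Pi.single i (N : ℤ))) ^ c i := by
  choose c hc using hv
  refine ⟨c, ?_⟩
  rw [ofAdd_eq_prod]
  refine Finset.prod_congr rfl fun i _ => ?_
  rw [← ofAdd_zsmul, ← Pi.single_smul, hc i, smul_eq_mul, mul_comm]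

include hφ in
lemma phi_U (l : ι) (v : ι → ℤ) (hv : ∀ i, (N : ℤ) ∣ v i) : φ (UE l (Multiplicative.ofAdd v)) = 1 := by
  suffices Multiplicative.ofAdd v ∈ (φ.comp (UE l)).ker from this
  obtain ⟨c, hc⟩ := split_dvd v hv
  rw [hc]
  refine Subgroup.prod_mem _ fun i _ => Subgroup.zpow_mem _ ?_ _
  rw [MonoidHom.mem_ker, MonoidHom.comp_apply]
  by_cases h : i = l
  · subst h
    have : UE i (Multiplicative.ofAdd (Pi.single i (N : ℤ))) = 1 := Subtype.ext (x_self i N)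
    rw [this, map_one]
  · exact hφ i l h

include hφ in
lemma phi_R (l : ι) (v : ι → ℤ) (hv : ∀ i, (N : ℤ) ∣ v i) : φ (RE l (Multiplicative.ofAdd v)) = 1 := by
  suffices Multiplicative.ofAdd v ∈ (φ.comp (RE l)).ker from this
  obtain ⟨c, hc⟩ := split_dvd v hv
  rw [hc]
  refine Subgroup.prod_mem _ fun i _ => Subgroup.zpow_mem _ ?_ _
  rw [MonoidHom.mem_ker, MonoidHom.comp_apply]
  by_cases h : i = l
  · subst h
    have : RE i (Multiplicative.ofAdd (Pi.single i (N : ℤ))) = 1 := Subtype.ext (R_self i N)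
    rw [this, map_one]
  · have : RE l (Multiplicative.ofAdd (Pi.single i (N : ℤ))) = xE (Ne.symm h) N :=
      Subtype.ext (R_val (Ne.symm h) N)
    rw [this, hφ]

lemma red_x {i j : ι} (h : i ≠ j) : red N ι (xE h N) = 1 := by
  change (Int.castRingHom (ZMod N)).mapMatrix (x i j N : Matrix ι ι ℤ) = 1
  rw [x_val h, map_add, map_one]
  ext a b
  simp [Matrix.single_apply]

/-- combined hom, used to treat `φ` and reduction uniformly -/
lemma red_U (l : ι) (v : ι → ℤ) (hv : ∀ i, (N : ℤ) ∣ v i) :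
    red N ι (UE l (Multiplicative.ofAdd v)) = 1 := by
  have := phi_U (N := N) (φ := (red N ι).toHomUnits) (fun i j h => Units.ext (red_x h)) l v hv
  exact congrArg Units.val this

lemma red_R (l : ι) (v : ι → ℤ) (hv : ∀ i, (N : ℤ) ∣ v i) :
    red N ι (RE l (Multiplicative.ofAdd v)) = 1 := by
  have := phi_R (N := N) (φ := (red N ι).toHomUnits) (fun i j h => Units.ext (red_x h)) l v hv
  exact congrArg Units.val this

include hφ in
lemma normal_form (h3 : ∀ i j : ι, ∃ k, k ≠ i ∧ k ≠ j) (l : ι) (g : EG ι) (hg : red N ι g = 1) :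
    ∃ g' : EG ι, φ g' = φ g ∧ red N ι g' = 1 ∧ (∀ i, g'.1.1 i l = if i = l then 1 else 0) ∧
      (∀ i, g'.1.1 l i = if l = i then 1 else 0) := by
  choose M hM using fun i => red_one hg i l
  have hinv : ∑ i, (g⁻¹).1.1 l i * g.1.1 i l = 1 := by
    have : (g⁻¹).1.1 * g.1.1 = 1 := by
      rw [← Units.val_mul, ← Subgroup.coe_mul]; simp
    have := congrFun (congrFun this l) l
    rwa [Matrix.mul_apply, Matrix.one_apply, if_pos rfl] at this
  have hll : g.1.1 l l = N * M l + 1 := by rw [hM l, if_pos rfl]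
  have hil : ∀ i, i ≠ l → g.1.1 i l = N * M i := fun i hi => by rw [hM i, if_neg hi, add_zero]
  have hu : ∑ i, off l (fun i => (g⁻¹).1.1 l i * N) i * M i + (g⁻¹).1.1 l l * g.1.1 l l = 1 := by
    rw [← hinv, ← Finset.add_sum_erase univ _ (mem_univ l),
      ← Finset.add_sum_erase univ (fun i => (g⁻¹).1.1 l i * g.1.1 i l) (mem_univ l), off_self,
      zero_mul, zero_add, add_comm]
    congr 1
    refine Finset.sum_congr rfl fun i hi => ?_
    have hi := ne_of_mem_erase hi
    rw [off_ne hi, hil i hi]; ring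
  obtain ⟨t, s, hts⟩ := stable_range h3 l _ _ _ _ hu
  set v1 : ι → ℤ := fun i => N * t i
  set w : ι → ℤ := fun i => - M l * s i
  set b' : ι → ℤ := fun i => M i + t i * g.1.1 l l with hb'
  set v2 : ι → ℤ := fun i => - (N * b' i)
  have d1 : ∀ i, (N : ℤ) ∣ v1 i := fun i => dvd_mul_right _ _
  have d2 : ∀ i, (N : ℤ) ∣ v2 i := fun i => (dvd_mul_right _ _).neg_right
  set g1 : EG ι := UE l (Multiplicative.ofAdd v1) * g with hg1
  set g2 : EG ι := RE l (Multiplicative.ofAdd w) * g1 with hg2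
  set g3 : EG ι := UE l (Multiplicative.ofAdd v2) * g2 with hg3
  set g4 : EG ι := (RE l (Multiplicative.ofAdd w))⁻¹ * g3 with hg4
  have r4 : red N ι g4 = 1 := by
    rw [hg4, hg3, hg2, hg1, map_mul, map_mul, map_mul, map_mul, red_U l v1 d1, red_U l v2 d2, hg,
      one_mul, one_mul, mul_one, ← map_mul, inv_mul_cancel, map_one]
  have p4 : φ g4 = φ g := by
    rw [hg4, hg3, hg2, hg1, map_mul, map_mul, map_mul, map_mul, phi_U hφ l v1 d1,
      phi_U hφ l v2 d2, one_mul, one_mul, map_inv, inv_mul_cancel_left]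
  have e1 : ∀ i j, g1.1.1 i j = g.1.1 i j + off l v1 i * g.1.1 l j :=
    fun i j => U_mul_apply l v1 g.1.1 i j
  have e2 : ∀ i j, g2.1.1 i j = g1.1.1 i j + if i = l then ∑ k, off l w k * g1.1.1 k j else 0 :=
    fun i j => R_mul_apply l w g1.1.1 i j
  have e3 : ∀ i j, g3.1.1 i j = g2.1.1 i j + off l v2 i * g2.1.1 l j :=
    fun i j => U_mul_apply l v2 g2.1.1 i j
  have e4 : ∀ i j, g4.1.1 i j = g3.1.1 i j + if i = l then ∑ k, off l (-w) k * g3.1.1 k j else 0 :=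
    fun i j => R_mul_apply l (-w) g3.1.1 i j
  have c1 : ∀ i, i ≠ l → g1.1.1 i l = N * b' i := by
    intro i hi; rw [e1, off_ne hi, hil i hi, hb']; ring
  have c1l : g1.1.1 l l = N * M l + 1 := by rw [e1, off_self, hll]; ring
  have c2 : ∀ i, i ≠ l → g2.1.1 i l = N * b' i := by
    intro i hi; rw [e2, if_neg hi, add_zero, c1 i hi]
  have c2l : g2.1.1 l l = 1 := by
    rw [e2, if_pos rfl, c1l]
    have : ∑ k, off l w k * g1.1.1 k l = - M l * N * ∑ i, off l s i * b' i := by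
      rw [mul_sum]
      refine Finset.sum_congr rfl fun k _ => ?_
      by_cases hk : k = l
      · subst hk; simp [off_self]
      · rw [off_ne hk, off_ne hk, c1 k hk]; ring
    rw [this, hts]; ring
  have c3 : ∀ i, g3.1.1 i l = if i = l then 1 else 0 := by
    intro i
    by_cases hi : i = l
    · subst hi; rw [e3, off_self, c2l]; simp
    · rw [e3, off_ne hi, c2 i hi, c2l, if_neg hi]; ring
  have c4 : ∀ i, g4.1.1 i l = if i = l then 1 else 0 := by
    intro i
    have : ∑ k, off l (-w) k * g3.1.1 k l = 0 := by
      refine Finset.sum_eq_zero fun k _ => ?_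
      rw [c3]
      split_ifs with h
      · rw [h, off_self, zero_mul]
      · simp
    rw [e4, c3, this]; simp
  choose M' hM' using fun i => red_one r4 l i
  set v5 : ι → ℤ := fun i => - (N * M' i)
  have d5 : ∀ i, (N : ℤ) ∣ v5 i := fun i => (dvd_mul_right _ _).neg_right
  set g5 : EG ι := g4 * RE l (Multiplicative.ofAdd v5) with hg5
  have e5 : ∀ i j, g5.1.1 i j = g4.1.1 i j + g4.1.1 i l * off l v5 j :=
    fun i j => mul_R_apply l v5 g4.1.1 i j
  refine ⟨g5, ?_, ?_, ?_, ?_⟩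
  · rw [hg5, map_mul, phi_R hφ l v5 d5, mul_one, p4]
  · rw [hg5, map_mul, red_R l v5 d5, mul_one, r4]
  · intro i
    rw [e5, off_self, mul_zero, add_zero, c4]
  · intro i
    by_cases hi : i = l
    · subst hi; rw [e5, off_self, c4]; simp
    · rw [e5, off_ne hi, c4, if_pos rfl, hM' i]; ring

include hφ in
lemma phi_comm_U (h3 : ∀ i j : ι, ∃ k, k ≠ i ∧ k ≠ j) (l : ι) (g : EG ι) (hg : red N ι g = 1)
    (v : ι → ℤ) : Commute (φ g) (φ (UE l (Multiplicative.ofAdd v))) := by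
  obtain ⟨g', h1, h2, h4, h5⟩ := normal_form hφ h3 l g hg
  rw [← h1]
  set w : ι → ℤ := g'.1.1 *ᵥ off l v with hw
  have hrow : Pi.single l 1 ᵥ* g'.1.1 = Pi.single l 1 := by
    ext j; simp [h5, Pi.single_apply, eq_comm]
  have hwl : off l w = w := by
    ext i
    by_cases hi : i = l
    · subst hi
      rw [off_self, hw, Matrix.mulVec, dotProduct, Finset.sum_eq_zero]
      intro k _
      rw [h5]; split_ifs with h
      · subst h; simp [off_self]
      · simp
    · rw [off_ne hi]
  have e : g' * UE l (Multiplicative.ofAdd v) = UE l (Multiplicative.ofAdd w) * g' := by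
    apply Subtype.ext
    apply Units.ext
    change g'.1.1 * Umat l v = Umat l w * g'.1.1
    rw [Umat, Umat, mul_add, add_mul, mul_vecMulVec, vecMulVec_mul, hrow, hwl, mul_one, one_mul]
  have e2 : φ (UE l (Multiplicative.ofAdd w)) = φ (UE l (Multiplicative.ofAdd v)) := by
    have : UE l (Multiplicative.ofAdd w) = UE l (Multiplicative.ofAdd (w - off l v)) *
        UE l (Multiplicative.ofAdd v) := by
      have h6 : UE l (Multiplicative.ofAdd v) = UE l (Multiplicative.ofAdd (off l v)) := by
        apply Subtype.ext; apply Units.ext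
        change Umat l v = Umat l (off l v)
        have : off l (off l v) = off l v := by ext i; simp only [off]; split_ifs <;> rfl
        rw [Umat, Umat, this]
      rw [h6, ← map_mul, ← ofAdd_add, sub_add_cancel]
    rw [this, map_mul, phi_U hφ, one_mul]
    intro i
    choose m hm using fun j => red_one h2 i j
    have : w i - off l v i = N * ∑ j, m j * off l v j := by
      rw [hw, Matrix.mulVec, dotProduct]
      simp only [hm, add_mul, sum_add_distrib, ite_mul, one_mul, zero_mul, sum_ite_eq, mem_univ,
        if_true, mul_sum, mul_assoc]
      ring
    rw [Pi.sub_apply, this]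
    exact dvd_mul_right _ _
  have := congrArg φ e
  rw [map_mul, map_mul, e2] at this
  exact this

include hφ in
lemma phi_comm (h3 : ∀ i j : ι, ∃ k, k ≠ i ∧ k ≠ j) (g : EG ι) (hg : red N ι g = 1)
    (e : EG ι) : Commute (φ g) (φ e) := by
  obtain ⟨e, he⟩ := e
  induction he using Subgroup.closure_induction with
  | mem y hy =>
    obtain ⟨i, j, hij, rfl⟩ := hy
    exact phi_comm_U hφ h3 j g hg (Pi.single i 1)
  | one => 
    have : (⟨1, one_mem _⟩ : EG ι) = 1 := rfl
    exact (congrArg φ this).trans (map_one φ) ▸ Commute.one_right _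
  | mul a b ha hb iha ihb => 
    have : (⟨a * b, mul_mem ha hb⟩ : EG ι) = ⟨a, ha⟩ * ⟨b, hb⟩ := rfl
    exact (congrArg φ this).trans (map_mul φ _ _) ▸ iha.mul_right ihb
  | inv a ha iha => 
    have : (⟨a⁻¹, inv_mem ha⟩ : EG ι) = ⟨a, ha⟩⁻¹ := rfl
    exact (congrArg φ this).trans (map_inv φ _) ▸ iha.inv_right

open scoped commutatorElement in
include hφ in
lemma finite_of_surj (h3 : ∀ i j : ι, ∃ k, k ≠ i ∧ k ≠ j) (hs : Function.Surjective φ) : Finite Q := by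
  classical
  have hcong : ∀ a a' : EG ι, red N ι a = red N ι a' → ∃ z, φ a' = φ a * z ∧ ∀ q, Commute z q := by
    intro a a' h
    refine ⟨φ (a⁻¹ * a'), by simp, fun q => ?_⟩
    obtain ⟨e, rfl⟩ := hs q
    refine phi_comm hφ h3 _ ?_ e
    rw [map_mul, ← h, ← map_mul, inv_mul_cancel, map_one]
  have hbr : ∀ a a' b b' : EG ι, red N ι a = red N ι a' → red N ι b = red N ι b' →
      ⁅φ a', φ b'⁆ = ⁅φ a, φ b⁆ := by
    intro a a' b b' ha hb
    obtain ⟨z, hz, cz⟩ := hcong a a' ha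
    obtain ⟨y, hy, cy⟩ := hcong b b' hb
    rw [hz, hy, commutatorElement_def, commutatorElement_def, _root_.mul_inv_rev, _root_.mul_inv_rev]
    have h1 : φ a * z * (φ b * y) * (z⁻¹ * (φ a)⁻¹) * (y⁻¹ * (φ b)⁻¹) =
      φ a * (z * (φ b * y * z⁻¹)) * (φ a)⁻¹ * (y⁻¹ * (φ b)⁻¹) := by group
    rw [h1, (cz _).eq]
    have h2 : φ a * (φ b * y * z⁻¹ * z) * (φ a)⁻¹ * (y⁻¹ * (φ b)⁻¹) =
      φ a * φ b * (y * ((φ a)⁻¹ * y⁻¹)) * (φ b)⁻¹ := by group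
    rw [h2, (cy _).eq]
    group
  have hfin : (commutatorSet Q).Finite := by
    set F : Matrix ι ι (ZMod N) × Matrix ι ι (ZMod N) → Q := fun p =>
      if h : ∃ a b : EG ι, red N ι a = p.1 ∧ red N ι b = p.2 then
        ⁅φ h.choose, φ h.choose_spec.choose⁆ else 1
    refine (Set.finite_range F).subset ?_
    rintro _ ⟨q1, q2, rfl⟩
    obtain ⟨a, rfl⟩ := hs q1
    obtain ⟨b, rfl⟩ := hs q2
    have h : ∃ a' b' : EG ι, red N ι a' = red N ι a ∧ red N ι b' = red N ι b := ⟨a, b, rfl, rfl⟩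
    refine ⟨(red N ι a, red N ι b), ?_⟩
    simp only [F]
    rw [dif_pos h]
    exact hbr _ _ _ _ h.choose_spec.choose_spec.1.symm h.choose_spec.choose_spec.2.symm
  have : Finite (commutatorSet Q) := hfin
  have hcf : Finite (_root_.commutator Q) := inferInstance
  have hperf : ∀ e : EG ι, φ e ∈ _root_.commutator Q := by
    rintro ⟨e, he⟩
    induction he using Subgroup.closure_induction with
    | mem y hy =>
      obtain ⟨i, j, hij, rfl⟩ := hy
      obtain ⟨k, hki, hkj⟩ := h3 i j
      have hx : xE hij 1 = ⁅xE hki.symm 1, xE hkj 1⁆ := by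
        apply Subtype.ext
        rw [commutatorElement_def]
        change x i j 1 = x i k 1 * x k j 1 * (x i k 1)⁻¹ * (x k j 1)⁻¹
        rw [x_lie hki.symm hkj hij]
        group
      change φ (xE hij 1) ∈ _
      rw [hx, map_commutatorElement]
      exact Subgroup.commutator_mem_commutator (Subgroup.mem_top _) (Subgroup.mem_top _)
    | one => 
      have : (⟨1, one_mem _⟩ : EG ι) = 1 := rfl
      exact (congrArg φ this).trans (map_one φ) ▸ one_mem _
    | mul a b ha hb iha ihb => 
      have : (⟨a * b, mul_mem ha hb⟩ : EG ι) = ⟨a, ha⟩ * ⟨b, hb⟩ := rfl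
      exact (congrArg φ this).trans (map_mul φ _ _) ▸ mul_mem iha ihb
    | inv a ha iha => 
      have : (⟨a⁻¹, inv_mem ha⟩ : EG ι) = ⟨a, ha⟩⁻¹ := rfl
      exact (congrArg φ this).trans (map_inv φ _) ▸ inv_mem iha
  have htop : _root_.commutator Q = ⊤ := by
    rw [eq_top_iff]
    intro q _
    obtain ⟨e, rfl⟩ := hs q
    exact hperf e
  rw [htop] at hcf
  exact Finite.of_equiv _ Subgroup.topEquiv.toEquiv

end
end Finiteness

/-! ### Part 6: the infinitesimal action -/

section Infinitesimal
open IsNilpotent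
variable {ι : Type*} [Fintype ι] [DecidableEq ι] {R : Type*} [Ring R] [Algebra ℚ R]

lemma exp_sub_one {X : R} (hX : IsNilpotent X) : ∃ Y, exp X = 1 + Y * X := by
  obtain ⟨a, ha⟩ := hX
  have ha' : X ^ (a + 1) = 0 := pow_eq_zero_of_le (by omega) ha
  refine ⟨∑ i ∈ range a, ((i + 1).factorial : ℚ)⁻¹ • X ^ i, ?_⟩
  rw [exp_eq_sum ha', sum_range_succ', sum_mul, add_comm]
  congr 1
  · simp
  · exact sum_congr rfl fun i _ => by rw [smul_mul_assoc, _root_.pow_succ]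

lemma exp_commute {X T : R} (hX : IsNilpotent X) (h : Commute X T) : Commute (exp X) T := by
  have := exp_conj (Z := 0) hX (by rw [h.eq, add_zero]) (Commute.zero_right _)
  rwa [add_zero] at this

/-- A homomorphism to a ring together with logarithms of the elementary matrices. -/
structure LogData (r : GL ι ℤ →* R) (N : ℕ) (X : ι → ι → R) : Prop where
  pos : N ≠ 0
  nil : ∀ i j, i ≠ j → IsNilpotent (X i j)
  hexp : ∀ i j, i ≠ j → IsNilpotent.exp (X i j) = r (x i j N)

variable {r : GL ι ℤ →* R} {N : ℕ} {X : ι → ι → R} (D : LogData r N X)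
include D

lemma LogData.comm_x {i j k l : ι} (hij : i ≠ j) (hkl : k ≠ l) (hjk : j ≠ k) (hil : i ≠ l) (c : ℤ) :
    Commute (X k l) (r (x i j c)) := by
  apply exp_intertwine (D.nil k l hkl) (D.nil k l hkl)
  rw [D.hexp k l hkl, ← map_mul, ← map_mul, (x_comm hij hkl hjk hil c N).eq]

lemma LogData.comm {i j k l : ι} (hij : i ≠ j) (hkl : k ≠ l) (hjk : j ≠ k) (hil : i ≠ l) :
    Commute (X i j) (X k l) := by
  have h := D.comm_x hij hkl hjk hil N
  rw [← D.hexp i j hij] at h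
  exact exp_intertwine (D.nil i j hij) (D.nil i j hij) h.symm

lemma LogData.conj {i j k : ι} (hij : i ≠ j) (hjk : j ≠ k) (hik : i ≠ k) (m : ℕ) :
    r (x i j m) * X j k = (X j k + (m : ℚ) • X i k) * r (x i j m) := by
  have hc : Commute (X j k) (X i k) := D.comm hjk hik hik.symm hjk
  have hc' : Commute (X j k) ((m : ℚ) • X i k) := hc.smul_right _
  have hn : IsNilpotent ((m : ℚ) • X i k) := (D.nil i k hik).smul _
  symm
  apply exp_intertwine (hc'.isNilpotent_add (D.nil j k hjk) hn) (D.nil j k hjk)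
  rw [exp_add_of_commute hc' (D.nil j k hjk) hn, ← exp_pow _ (D.nil i k hik), D.hexp j k hjk,
    D.hexp i k hik, ← map_pow, ← map_mul, ← map_mul, ← map_mul, x_pow, x_lie hij hjk hik,
    (x_comm hjk hik hik.symm hjk _ _).eq]

lemma LogData.conj2 {i j k : ι} (hij : i ≠ j) (hjk : j ≠ k) (hik : i ≠ k) :
    r (x i j 1) * X k i = (X k i - X k j) * r (x i j 1) := by
  have hc : Commute (X k j) (X k i) := D.comm hjk.symm hik.symm hjk hik.symm
  have hn := hc.isNilpotent_add (D.nil k j hjk.symm) (D.nil k i hik.symm)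
  have h1 : X k i * r (x i j 1) = r (x i j 1) * (X k j + X k i) := by
    apply exp_intertwine (D.nil k i hik.symm) hn
    rw [exp_add_of_commute hc (D.nil k j hjk.symm) (D.nil k i hik.symm), D.hexp k i hik.symm,
      D.hexp k j hjk.symm, ← map_mul, ← map_mul, ← map_mul, x_lie hik.symm hij hjk.symm, mul_one,
      ← mul_assoc, (x_comm hij hjk.symm hjk hij _ _).eq]
  rw [mul_add, ← (D.comm_x hij hjk.symm hjk hij 1).eq] at h1
  rw [sub_mul, h1]; abel

lemma LogData.lie {i j k : ι} (hij : i ≠ j) (hjk : j ≠ k) (hik : i ≠ k) :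
    X i j * X j k = X j k * X i j + (N : ℚ) • X i k := by
  apply exp_lie (D.nil i j hij)
  intro m
  rw [D.hexp i j hij, ← map_pow, x_pow]
  have := D.conj hij hjk hik (m * N)
  push_cast at this
  rw [this, smul_smul]

lemma LogData.stein : Stein (fun i j => (N : ℚ)⁻¹ • X i j) where
  lie i j k hij hjk hik := by
    have hN : (N : ℚ) ≠ 0 := Nat.cast_ne_zero.mpr D.pos
    simp only [smul_mul_smul_comm]
    rw [D.lie hij hjk hik, smul_add, smul_smul]
    congr 2
    field_simp
  comm i j k l hij hkl hjk hil := ((D.comm hij hkl hjk hil).smul_left _).smul_right _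

lemma LogData.cas (K : Type*) [Field K] [CharZero K] [Algebra K R]
    (h3 : ∀ i j : ι, ∃ k, k ≠ i ∧ k ≠ j) {k l : ι} (hkl : k ≠ l) :
    Commute (r (x k l 1)) (Cas K (fun i j => (N : ℚ)⁻¹ • X i j)) := by
  have hS := D.stein
  set Y : ι → ι → R := fun i j => (N : ℚ)⁻¹ • X i j with hY
  have hN : (N : ℚ) ≠ 0 := Nat.cast_ne_zero.mpr D.pos
  have hn : IsNilpotent (Y k l) := (D.nil k l hkl).smul _
  set S := r (x k l 1)
  set e := exp (Y k l)
  set s := exp (- Y k l) * S with hs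
  have hes : S = e * s := by rw [hs, ← mul_assoc, exp_mul_exp_neg_self hn, one_mul]
  have key : ∀ T Z, Commute (Y k l) Z → Y k l * T = T * Y k l + Z → S * T = (T + Z) * S →
      Commute s T := by
    intro T Z hZ h1 h2
    have h4 := exp_conj hn h1 hZ
    have h5 : exp (- Y k l) * (T + Z) = T * exp (- Y k l) := by
      have : exp (- Y k l) * (e * T) * exp (- Y k l) = exp (- Y k l) * ((T + Z) * e) * exp (- Y k l) := by
        rw [h4]
      rw [← mul_assoc, exp_neg_mul_exp_self hn, one_mul, mul_assoc, mul_assoc (T + Z),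
        exp_mul_exp_neg_self hn, mul_one] at this
      exact this.symm
    change s * T = T * s
    rw [hs, mul_assoc, h2, ← mul_assoc, h5, mul_assoc]
  have hgen : ∀ i j, i ≠ j → ¬ (i = l ∧ j = k) → Commute s (Y i j) := by
    intro i j hij hne
    by_cases hil : i = l
    · subst hil
      have hjk : j ≠ k := fun h => hne ⟨rfl, h⟩
      refine key _ (Y k j) (hS.comm k i k j hkl hjk.symm hkl.symm hjk.symm)
        (hS.lie k i j hkl hij hjk.symm) ?_
      have := D.conj hkl hij hjk.symm 1
      rw [Nat.cast_one, Nat.cast_one, one_smul] at this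
      simp only [hY, mul_smul_comm, ← smul_add, smul_mul_assoc]
      rw [this]
    · by_cases hjk : j = k
      · subst hjk
        refine key _ (- Y i l) (hS.comm j l i l hkl hil (Ne.symm hil) hkl).neg_right ?_ ?_
        · rw [hS.lie i j l hij hkl hil]; abel
        · have := D.conj2 hkl (Ne.symm hil) hij.symm
          simp only [hY, mul_smul_comm, ← smul_add, smul_mul_assoc, ← smul_neg]
          rw [this, sub_eq_add_neg]
      · refine key _ 0 (Commute.zero_right _) ?_ ?_
        · rw [(hS.comm k l i j hkl hij (Ne.symm hil) (Ne.symm hjk)).eq, add_zero]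
        · rw [add_zero]
          exact ((D.comm_x hkl hij (Ne.symm hil) (Ne.symm hjk) 1).smul_left _).symm.eq
  have hall : ∀ i j, i ≠ j → Commute s (Y i j) := by
    intro i j hij
    by_cases h : i = l ∧ j = k
    · obtain ⟨rfl, rfl⟩ := h
      obtain ⟨m, h1, h2⟩ := h3 i j
      have hl := hS.lie i m j h1.symm h2 hij
      have e1 : Y i j = Y i m * Y m j - Y m j * Y i m := by
        change Y i m * Y m j = Y m j * Y i m + Y i j at hl
        rw [hl]; abel
      rw [e1]
      have c1 := hgen i m h1.symm (by tauto)
      have c2 := hgen m j h2 (by tauto)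
      exact (c1.mul_right c2).sub_right (c2.mul_right c1)
    · exact hgen i j hij h
  have hsC : Commute s (Cas K Y) := comm_cas hall
  have heC : Commute e (Cas K Y) := exp_commute hn (cas_comm h3 hS hkl).symm
  rw [hes]
  exact heC.mul_left hsC

end Infinitesimal

/-! ### Part 7: invariant vectors -/

section QuasiUnipotent
variable {K A : Type*} [Field K] [IsAlgClosed K] [AddCommGroup A] [Module K A]
  [FiniteDimensional K A]

lemma isNilpotent_of_eigenvalue {T : Module.End K A} (h : ∀ μ : K, T.HasEigenvalue μ → μ = 0) :
    IsNilpotent T := by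
  have hz : ∀ μ : K, μ ≠ 0 → T.maxGenEigenspace μ = ⊥ := by
    intro μ hμ
    by_contra hne
    apply hμ
    apply h
    apply Module.End.hasEigenvalue_of_hasGenEigenvalue (k := T.maxGenEigenspaceIndex μ)
    rw [Module.End.HasGenEigenvalue, Module.End.HasUnifEigenvalue]
    rwa [Module.End.maxGenEigenspace_eq] at hne
  have htop := Module.End.iSup_maxGenEigenspace_eq_top T
  have h0 : T.maxGenEigenspace 0 = ⊤ := by
    rw [← htop]
    apply le_antisymm (le_iSup _ _)
    apply iSup_le
    intro μ
    by_cases hμ : μ = 0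
    · rw [hμ]
    · rw [hz μ hμ]; exact bot_le
  refine ⟨Module.finrank K A, ?_⟩
  ext a
  have ha : a ∈ T.maxGenEigenspace 0 := by rw [h0]; trivial
  rw [Module.End.maxGenEigenspace_eq_genEigenspace_finrank, Module.End.mem_genEigenspace_nat] at ha
  simpa using ha

lemma eigenvalue_root {z a b : Module.End K A} (hab : a * b = z * (b * a)) (hza : Commute z a)
    (hzb : Commute z b) (ha : Function.Injective a) (hb : Function.Injective b) {μ : K}
    (hμ : z.HasEigenvalue μ) : μ ^ (Module.finrank K A).factorial = 1 := by
  set W := z.eigenspace μ with hW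
  have st : ∀ c : Module.End K A, Commute z c → ∀ w ∈ W, c w ∈ W := by
    intro c hc w hw
    rw [hW, Module.End.mem_eigenspace_iff] at hw ⊢
    rw [← Module.End.mul_apply, hc.eq, Module.End.mul_apply, hw, map_smul]
  set a1 := a.restrict (st a hza)
  set b1 := b.restrict (st b hzb)
  have da : LinearMap.det a1 ≠ 0 := by
    have : Function.Injective a1 := fun u v h => Subtype.ext (ha (congrArg Subtype.val h))
    intro h0
    have h1 := LinearMap.bot_lt_ker_of_det_eq_zero h0
    rw [LinearMap.ker_eq_bot.mpr this] at h1
    exact lt_irrefl _ h1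
  have db : LinearMap.det b1 ≠ 0 := by
    have : Function.Injective b1 := fun u v h => Subtype.ext (hb (congrArg Subtype.val h))
    intro h0
    have h1 := LinearMap.bot_lt_ker_of_det_eq_zero h0
    rw [LinearMap.ker_eq_bot.mpr this] at h1
    exact lt_irrefl _ h1
  have hrel : a1 * b1 = μ • (b1 * a1) := by
    ext w
    have h1 := LinearMap.congr_fun hab w.1
    have h2 : b (a w.1) ∈ W := st b hzb _ (st a hza _ w.2)
    replace h2 := Module.End.mem_eigenspace_iff.mp h2
    simp only [Module.End.mul_apply] at h1
    rw [h2] at h1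
    exact h1
  have hd := congrArg LinearMap.det hrel
  rw [LinearMap.det_smul, map_mul, map_mul] at hd
  have hd1 : μ ^ Module.finrank K W = 1 := by
    have : (μ ^ Module.finrank K W - 1) * (LinearMap.det b1 * LinearMap.det a1) = 0 := by
      rw [sub_mul, ← hd]; ring
    rcases mul_eq_zero.mp this with h | h
    · exact sub_eq_zero.mp h
    · exact absurd h (mul_ne_zero db da)
  have hpos : 0 < Module.finrank K W := by
    have : Nontrivial W := Submodule.nontrivial_iff_ne_bot.mpr hμ
    exact Module.finrank_pos
  obtain ⟨m, hm⟩ := Nat.dvd_factorial hpos (Submodule.finrank_le W)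
  rw [hm, pow_mul, hd1, one_pow]

lemma isNilpotent_pow_sub_one {z : Module.End K A} {N : ℕ} 
    (h : ∀ μ : K, z.HasEigenvalue μ → μ ^ N = 1) : IsNilpotent (z ^ N - 1) := by
  rcases subsingleton_or_nontrivial A with hA | hA
  · exact ⟨1, Subsingleton.elim _ _⟩
  apply isNilpotent_of_eigenvalue
  intro ν hν
  have h1 := hν.mem_spectrum
  have h2 : z ^ N - 1 = Polynomial.aeval z (Polynomial.X ^ N - 1 : Polynomial K) := by simp
  rw [h2, spectrum.map_polynomial_aeval_of_nonempty] at h1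
  · obtain ⟨μ, hμ, rfl⟩ := h1
    rw [← Module.End.hasEigenvalue_iff_mem_spectrum] at hμ
    simp [h μ hμ]
  · exact spectrum.nonempty_of_isAlgClosed_of_finiteDimensional K z

end QuasiUnipotent

section Invariant
variable {K A : Type*} [Field K] [CharZero K] [IsAlgClosed K] [AddCommGroup A] [Module K A]
  [FiniteDimensional K A] {ι : Type*} [Fintype ι] [DecidableEq ι]

lemma exists_logData [Algebra ℚ (Module.End K A)] (r : GL ι ℤ →* Module.End K A)
    (h3 : ∀ i j : ι, ∃ k, k ≠ i ∧ k ≠ j) :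
    ∃ (N : ℕ) (X : ι → ι → Module.End K A), LogData r N X ∧ ∀ i, X i i = 0 := by
  have hinj : ∀ g, Function.Injective (r g) := by
    intro g a b h
    have := congrArg (r g⁻¹) h
    simpa only [← Module.End.mul_apply, ← map_mul, inv_mul_cancel, map_one,
      Module.End.one_apply] using this
  set N := (Module.finrank K A).factorial with hN
  have hnil : ∀ i k, i ≠ k → IsNilpotent (r (x i k N) - 1) := by
    intro i k hik
    obtain ⟨j, hji, hjk⟩ := h3 i k
    have h1 : x i k N = x i k 1 ^ N := by rw [x_pow, mul_one]
    rw [h1, map_pow]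
    apply isNilpotent_pow_sub_one
    intro μ hμ
    refine eigenvalue_root (a := r (x i j 1)) (b := r (x j k 1)) ?_ ?_ ?_ (hinj _) (hinj _) hμ
    · rw [← map_mul, ← map_mul, ← map_mul, x_lie hji.symm hjk hik, mul_one, mul_assoc]
    · exact (x_comm hik hji.symm hik.symm hji.symm 1 1).map r
    · exact (x_comm hik hjk hjk.symm hik 1 1).map r
  have hlog : ∀ i k, ∃ X : Module.End K A, (i ≠ k → IsNilpotent X ∧ IsNilpotent.exp X = r (x i k N)) ∧
      (i = k → X = 0) := by
    intro i k
    by_cases h : i = k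
    · exact ⟨0, fun h' => absurd h h', fun _ => rfl⟩
    · obtain ⟨X, hX⟩ := exists_log (hnil i k h)
      exact ⟨X, fun _ => hX, fun h' => absurd h' h⟩
  choose X hX hX0 using hlog
  exact ⟨N, X, ⟨Nat.factorial_ne_zero _, fun i j h => (hX i j h).1, fun i j h => (hX i j h).2⟩,
    fun i => hX0 i i rfl⟩

/-- Operators commuting with `C` act on the kernel of `C ^ n`. -/
noncomputable def kerHom (C : Module.End K A) (n : ℕ) :
    Subalgebra.centralizer K {C} →ₐ[K] Module.End K (LinearMap.ker (C ^ n)) :=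
  AlgHom.ofLinearMap
    { toFun := fun T => T.1.restrict (p := LinearMap.ker (C ^ n)) (q := LinearMap.ker (C ^ n)) (by
        intro a ha
        have hc : Commute (C ^ n) T.1 :=
          Commute.pow_left (Subalgebra.mem_centralizer_iff K |>.mp T.2 C rfl) n
        rw [LinearMap.mem_ker] at ha ⊢
        rw [← Module.End.mul_apply, hc.eq, Module.End.mul_apply, ha, map_zero])
      map_add' := fun S T => rfl
      map_smul' := fun c T => rfl }
    rfl (fun S T => rfl)

lemma kerHom_apply (C : Module.End K A) (n : ℕ) (T : Subalgebra.centralizer K {C})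
    (a : LinearMap.ker (C ^ n)) : (kerHom C n T a : A) = T.1 a.1 := rfl

lemma map_cas {R S : Type*} [Ring R] [Ring S] [Algebra K R] [Algebra K S] (φ : R →ₐ[K] S)
    (X : ι → ι → R) : φ (Cas K X) = Cas K (fun i j => φ (X i j)) := by
  simp only [Cas, EE, DD, HH, map_sum, map_mul, apply_ite φ, map_smul, map_sub]

lemma ker_trivial (h3 : ∀ i j : ι, ∃ k, k ≠ i ∧ k ≠ j) {Y : ι → ι → Module.End K A} (hY : Stein Y)
    (hnil : ∀ i j, i ≠ j → IsNilpotent (Y i j)) (h0 : ∀ i, Y i i = 0) (n : ℕ) {i j : ι} (hij : i ≠ j)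
    {a : A} (ha : (Cas K Y ^ n) a = 0) : Y i j a = 0 := by
  set C := Cas K Y with hC
  have hmem : ∀ i j, Y i j ∈ Subalgebra.centralizer K {C} := by
    intro i j
    rw [Subalgebra.mem_centralizer_iff]
    rintro _ rfl
    by_cases h : i = j
    · rw [h, h0]; simp
    · exact cas_comm h3 hY h
  set Y1 : ι → ι → Subalgebra.centralizer K {C} := fun i j => ⟨Y i j, hmem i j⟩ with hY1
  have hY1S : Stein Y1 :=
    ⟨fun i j k h1 h2 h4 => Subtype.ext (hY.lie i j k h1 h2 h4),
      fun i j k l h1 h2 h4 h5 => Subtype.ext (hY.comm i j k l h1 h2 h4 h5)⟩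
  set Z : ι → ι → Module.End K (LinearMap.ker (C ^ n)) := fun i j => kerHom C n (Y1 i j) with hZ
  have hZS : Stein Z :=
    ⟨fun i j k h1 h2 h4 => by
        simp only [hZ, ← map_mul, ← map_add]; rw [hY1S.lie i j k h1 h2 h4],
      fun i j k l h1 h2 h4 h5 => (hY1S.comm i j k l h1 h2 h4 h5).map (kerHom C n)⟩
  have hZn : ∀ i j, i ≠ j → IsNilpotent (Z i j) := by
    intro i j h
    obtain ⟨m, hm⟩ := hnil i j h
    refine ⟨m, ?_⟩
    have : Y1 i j ^ m = 0 := Subtype.ext hm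
    simp only [hZ]
    rw [← map_pow, this, map_zero]
  have hC1 : ((Cas K Y1 : Subalgebra.centralizer K {C}) : Module.End K A) = C :=
    map_cas (Subalgebra.centralizer K {C}).val Y1
  have hZC : IsNilpotent (Cas K Z) := by
    refine ⟨n, ?_⟩
    have : Cas K Z = kerHom C n (Cas K Y1) := (map_cas (kerHom C n) Y1).symm
    rw [this, ← map_pow]
    ext b
    rw [kerHom_apply]
    rw [SubmonoidClass.coe_pow, hC1]
    exact b.2
  have := trivial_of_cas_nilpotent h3 hZS hZn hZC hij
  exact congrArg Subtype.val (LinearMap.congr_fun this ⟨a, ha⟩)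

lemma comp_cas {f : A →ₗ[K] K} {Y : ι → ι → Module.End K A} (h : ∀ i j a, f (Y i j a) = 0) (a : A) :
    f (Cas K Y a) = 0 := by
  have hH : ∀ i j a, f (HH Y i j a) = 0 := by
    intro i j a
    simp [HH, h]
  have hD : ∀ i a, f (DD K Y i a) = 0 := by
    intro i a
    simp [DD, hH]
  have hE : ∀ i j a, f (EE K Y i j a) = 0 := by
    intro i j a
    unfold EE
    split_ifs
    · exact hD _ _
    · exact h _ _ _
  simp [Cas, hE]

lemma comp_log [Algebra ℚ (Module.End K A)] {f : A →ₗ[K] K} {X : Module.End K A} (hX : IsNilpotent X)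
    (h : ∀ a, f (IsNilpotent.exp X a) = f a) (a : A) : f (X a) = 0 := by
  by_contra hne
  have hv : f.smulRight (X a) * X = 0 := by
    have := exp_intertwine (X := 0) (Y := X) (T := f.smulRight (X a)) IsNilpotent.zero hX (by
      rw [IsNilpotent.exp_zero, one_mul]
      ext b
      simp [h])
    rw [← this, zero_mul]
  have h1 := LinearMap.congr_fun hv a
  simp only [Module.End.mul_apply, LinearMap.smulRight_apply, LinearMap.zero_apply] at h1
  have h2 := congrArg f h1
  rw [map_smul, map_zero, smul_eq_mul, mul_self_eq_zero] at h2
  exact hne h2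

lemma average {G : Type*} [Group G] (r : G →* Module.End K A) (f : A →ₗ[K] K)
    (hf : ∀ g a, f (r g a) = f a) (a₀ : A) (h1 : f a₀ = 1)
    (hfin : (Set.range fun g => r g a₀).Finite) : ∃ a, (∀ g, r g a = a) ∧ f a = 1 := by
  have hS : ∀ v, v ∈ hfin.toFinset ↔ ∃ g, r g a₀ = v := by
    intro v; simp
  set S := hfin.toFinset
  have hc : (#S : K) ≠ 0 := by
    rw [Nat.cast_ne_zero, Finset.card_ne_zero]
    exact ⟨r 1 a₀, (hS _).mpr ⟨1, rfl⟩⟩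
  refine ⟨(#S : K)⁻¹ • ∑ v ∈ S, v, ?_, ?_⟩
  · intro g
    rw [map_smul, map_sum]
    congr 1
    have hin : ∀ h : G, ∀ v ∈ S, r h v ∈ S := by
      intro h v hv
      obtain ⟨k, rfl⟩ := (hS v).mp hv
      exact (hS _).mpr ⟨h * k, by rw [map_mul]; rfl⟩
    refine Finset.sum_nbij' (fun v => r g v) (fun v => r g⁻¹ v) (hin g) (hin g⁻¹) ?_ ?_ ?_
    · intro v _
      rw [← Module.End.mul_apply, ← map_mul, inv_mul_cancel, map_one, Module.End.one_apply]
    · intro v _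
      rw [← Module.End.mul_apply, ← map_mul, mul_inv_cancel, map_one, Module.End.one_apply]
    · intro v _
      rfl
  · rw [map_smul, map_sum, Finset.sum_congr rfl (g := fun _ => (1 : K))]
    · simp [hc]
    · intro v hv
      obtain ⟨k, rfl⟩ := (hS v).mp hv
      rw [hf, h1]

lemma finite_small : {m : GL ι ℤ | ∀ i j, m.1 i j ∈ Set.Icc (-1 : ℤ) 1}.Finite := by
  have h : {m : Matrix ι ι ℤ | ∀ i j, m i j ∈ Set.Icc (-1 : ℤ) 1}.Finite := by
    have : (Set.univ.pi fun _ : ι => Set.univ.pi fun _ : ι => Set.Icc (-1 : ℤ) 1).Finite :=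
      Set.Finite.pi fun _ => Set.Finite.pi fun _ => Set.finite_Icc _ _
    exact this.subset fun m hm i _ j _ => hm i j
  exact h.preimage (Units.val_injective.injOn)

theorem exists_invariant [Algebra ℚ (Module.End K A)] (r : GL ι ℤ →* Module.End K A)
    (h3 : ∀ i j : ι, ∃ k, k ≠ i ∧ k ≠ j) (f : A →ₗ[K] K) (hf : ∀ g a, f (r g a) = f a)
    (hne : ∃ v, f v = 1) : ∃ a, (∀ g, r g a = a) ∧ f a = 1 := by
  obtain ⟨N, X, D, hX0⟩ := exists_logData r h3
  have hS := D.stein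
  have hcas := fun k l (h : k ≠ l) => D.cas K h3 h
  set Y : ι → ι → Module.End K A := fun i j => (N : ℚ)⁻¹ • X i j with hY
  have hYnil : ∀ i j, i ≠ j → IsNilpotent (Y i j) := fun i j h => (D.nil i j h).smul _
  have hY0 : ∀ i, Y i i = 0 := fun i => by simp only [hY, hX0, smul_zero]
  have hN : (N : ℚ) ≠ 0 := Nat.cast_ne_zero.mpr D.pos
  have hXY : ∀ i j, X i j = (N : ℚ) • Y i j := fun i j => by
    simp only [hY, smul_smul, mul_inv_cancel₀ hN, one_smul]
  set C := Cas K Y with hC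
  have hsm : ∀ (q : ℚ) (T : Module.End K A), q • T = T * (q • (1 : Module.End K A)) := by
    intro q T
    rw [mul_smul_comm, mul_one]
  have hfX : ∀ i j a, f (X i j a) = 0 := by
    intro i j a
    by_cases h : i = j
    · rw [h, hX0]; simp
    · refine comp_log (D.nil i j h) ?_ a
      intro b
      rw [D.hexp i j h, hf]
  have hfY : ∀ i j a, f (Y i j a) = 0 := by
    intro i j a
    simp only [hY]
    rw [hsm]
    exact hfX _ _ _
  have hfC : ∀ a, f (C a) = 0 := comp_cas hfY
  obtain ⟨n, hn, hn1⟩ := ((LinearMap.eventually_isCompl_ker_pow_range_pow C).and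
    (Filter.eventually_ge_atTop 1)).exists
  obtain ⟨v, hv⟩ := hne
  obtain ⟨a₀, ha₀, hfa₀⟩ : ∃ a₀, (C ^ n) a₀ = 0 ∧ f a₀ = 1 := by
    have : v ∈ LinearMap.ker (C ^ n) ⊔ LinearMap.range (C ^ n) := by
      rw [hn.sup_eq_top]; trivial
    obtain ⟨a, ha, _, ⟨b, rfl⟩, hab⟩ := Submodule.mem_sup.mp this
    refine ⟨a, ha, ?_⟩
    obtain ⟨m, rfl⟩ : ∃ m, n = m + 1 := ⟨n - 1, by omega⟩
    rw [← hv, ← hab, map_add, pow_succ', Module.End.mul_apply, hfC, add_zero]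
  have hfix : ∀ i j, i ≠ j → ∀ a, (C ^ n) a = 0 → r (x i j N) a = a := by
    intro i j hij a ha
    have h1 := ker_trivial h3 hS hYnil hY0 n hij ha
    have h2 : X i j a = 0 := by
      have h4 : X i j = ((N : ℚ) • (1 : Module.End K A)) * Y i j := by rw [hXY, smul_one_mul]
      rw [h4, Module.End.mul_apply, h1, map_zero]
    obtain ⟨T, hT⟩ := exp_sub_one (D.nil i j hij)
    rw [← D.hexp i j hij, hT, LinearMap.add_apply, Module.End.mul_apply, h2, map_zero, add_zero,
      Module.End.one_apply]
  have hcomm : ∀ e ∈ EG ι, Commute (r e) C := by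
    intro e he
    induction he using Subgroup.closure_induction with
    | mem g hg =>
      obtain ⟨i, j, hij, rfl⟩ := hg
      exact hcas i j hij
    | one => rw [map_one]; exact Commute.one_left _
    | mul g h _ _ hg hh => rw [map_mul]; exact hg.mul_left hh
    | inv g _ hg =>
      have h1 : r g⁻¹ * r g = 1 := by rw [← map_mul, inv_mul_cancel, map_one]
      have h2 : r g * r g⁻¹ = 1 := by rw [← map_mul, mul_inv_cancel, map_one]
      change r g⁻¹ * C = C * r g⁻¹
      calc r g⁻¹ * C = r g⁻¹ * C * (r g * r g⁻¹) := by rw [h2, mul_one]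
        _ = r g⁻¹ * (C * r g) * r g⁻¹ := by simp only [mul_assoc]
        _ = r g⁻¹ * (r g * C) * r g⁻¹ := by rw [hg.eq]
        _ = (r g⁻¹ * r g) * C * r g⁻¹ := by simp only [mul_assoc]
        _ = C * r g⁻¹ := by rw [h1, one_mul]
  set ψ0 : EG ι →* Subalgebra.centralizer K {C} :=
    (r.comp (EG ι).subtype).codRestrict (Subalgebra.centralizer K {C}) (by
      intro e
      rw [Subalgebra.mem_centralizer_iff]
      rintro _ rfl
      exact (hcomm e.1 e.2).eq.symm) with hψ0
  set ψ1 : EG ι →* Module.End K (LinearMap.ker (C ^ n)) :=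
    ((kerHom C n : _ →* Module.End K (LinearMap.ker (C ^ n)))).comp ψ0 with hψ1
  have hψ1a : ∀ e a, (ψ1 e a : A) = r e.1 a.1 := fun e a => rfl
  set ψ := ψ1.toHomUnits with hψ
  have : NeZero N := ⟨D.pos⟩
  have hfinQ : Finite ψ.range := by
    refine finite_of_surj (N := N) (φ := ψ.rangeRestrict) ?_ h3 ψ.rangeRestrict_surjective
    intro i j hij
    apply Subtype.ext
    apply Units.ext
    ext a
    exact hfix i j hij a.1 a.2
  have hEfin : {w : A | ∃ e ∈ EG ι, r e a₀ = w}.Finite := by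
    have h1 : (Set.range fun u : ψ.range => (((u.1 : Module.End K (LinearMap.ker (C ^ n)))
      ⟨a₀, ha₀⟩ : LinearMap.ker (C ^ n)) : A)).Finite := Set.finite_range _
    refine h1.subset ?_
    rintro _ ⟨e, he, rfl⟩
    exact ⟨⟨ψ ⟨e, he⟩, ⟨e, he⟩, rfl⟩, rfl⟩
  refine average r f hf a₀ hfa₀ ?_
  have hU : (⋃ m ∈ {m : GL ι ℤ | ∀ i j, m.1 i j ∈ Set.Icc (-1 : ℤ) 1},
      (fun w => r m⁻¹ w) '' {w : A | ∃ e ∈ EG ι, r e a₀ = w}).Finite :=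
    finite_small.biUnion fun m _ => hEfin.image _
  refine hU.subset ?_
  rintro _ ⟨g, rfl⟩
  obtain ⟨e, he, hm⟩ := gen g⁻¹
  refine Set.mem_biUnion (x := e * g⁻¹) hm ⟨r e a₀, ⟨e, he, rfl⟩, ?_⟩
  change r (e * g⁻¹)⁻¹ (r e a₀) = r g a₀
  rw [← Module.End.mul_apply, ← map_mul]
  congr 2
  group

end Invariant

section Rational

theorem exists_invariant_rat {A : Type*} [AddCommGroup A] [Module ℚ A] [FiniteDimensional ℚ A]
    {ι : Type*} [Fintype ι] [DecidableEq ι] (r : GL ι ℤ →* Module.End ℚ A)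
    (h3 : ∀ i j : ι, ∃ k, k ≠ i ∧ k ≠ j) (f : A →ₗ[ℚ] ℚ) (hf : ∀ g a, f (r g a) = f a)
    (hne : ∃ v, f v = 1) : ∃ a, (∀ g, r g a = a) ∧ f a = 1 := by
  let K := AlgebraicClosure ℚ
  let B := TensorProduct ℚ K A
  let rK : GL ι ℤ →* Module.End K B :=
    { toFun := fun g => (r g).baseChange K
      map_one' := by rw [map_one]; exact LinearMap.baseChange_id
      map_mul' := fun g h => by rw [map_mul]; exact LinearMap.baseChange_comp (r h) (r g) }
  let fK : B →ₗ[K] K := (TensorProduct.AlgebraTensorModule.rid ℚ K K).toLinearMap ∘ₗ f.baseChange K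
  have hrK : ∀ g c a, rK g (c ⊗ₜ[ℚ] a) = c ⊗ₜ[ℚ] r g a := fun g c a => rfl
  have hfK : ∀ c a, fK (c ⊗ₜ[ℚ] a) = f a • c := fun c a => rfl
  obtain ⟨v, hv⟩ := hne
  obtain ⟨w, hw, hw1⟩ := exists_invariant rK h3 fK (by
    intro g b
    induction b using TensorProduct.induction_on with
    | zero => simp
    | tmul c a => rw [hrK, hfK, hfK, hf]
    | add b c hb hc => rw [map_add, map_add, map_add, hb, hc]) ⟨1 ⊗ₜ[ℚ] v, by rw [hfK, hv, one_smul]⟩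
  obtain ⟨s, hs⟩ : ∃ s : K →ₗ[ℚ] ℚ, s 1 = 1 := by
    obtain ⟨s, hs⟩ := LinearMap.exists_leftInverse_of_injective (Algebra.linearMap ℚ K)
      (LinearMap.ker_eq_bot.mpr (algebraMap ℚ K).injective)
    refine ⟨s, ?_⟩
    have := LinearMap.congr_fun hs 1
    simpa using this
  let p : B →ₗ[ℚ] A := (TensorProduct.lid ℚ A).toLinearMap ∘ₗ s.rTensor A
  have hp : ∀ c a, p (c ⊗ₜ[ℚ] a) = s c • a := fun c a => rfl
  have hpr : ∀ g b, r g (p b) = p (rK g b) := by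
    intro g b
    induction b using TensorProduct.induction_on with
    | zero => simp
    | tmul c a => rw [hrK, hp, hp, map_smul]
    | add b c hb hc => rw [map_add, map_add, map_add, map_add, hb, hc]
  have hpf : ∀ b, f (p b) = s (fK b) := by
    intro b
    induction b using TensorProduct.induction_on with
    | zero => simp
    | tmul c a => rw [hfK, hp, map_smul, map_smul, smul_eq_mul, smul_eq_mul, mul_comm]
    | add b c hb hc => rw [map_add, map_add, map_add, map_add, hb, hc]
  exact ⟨p w, fun g => by rw [hpr, hw], by rw [hpf, hw1, hs]⟩

theorem exists_section {ι : Type*} [Fintype ι] [DecidableEq ι]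
    (h3 : ∀ i j : ι, ∃ k, k ≠ i ∧ k ≠ j)
    {E V : Type*} [AddCommGroup E] [Module ℚ E] [FiniteDimensional ℚ E]
    [AddCommGroup V] [Module ℚ V] [FiniteDimensional ℚ V]
    (ρE : Representation ℚ (GL ι ℤ) E) (ρV : Representation ℚ (GL ι ℤ) V) (g : E →ₗ[ℚ] V)
    (hg : ∀ (γ : GL ι ℤ) (e : E), g (ρE γ e) = ρV γ (g e)) (hsurj : Function.Surjective g) :
    ∃ s : V →ₗ[ℚ] E, (∀ (γ : GL ι ℤ) (v : V), s (ρV γ v) = ρE γ (s v)) ∧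
      g ∘ₗ s = LinearMap.id := by
  let A : Submodule ℚ ((V →ₗ[ℚ] E) × ℚ) :=
    { carrier := {q | ∀ v, g (q.1 v) = q.2 • v}
      add_mem' := fun {a b} ha hb v => by
        rw [Prod.fst_add, Prod.snd_add, LinearMap.add_apply, map_add, ha v, hb v, add_smul]
      zero_mem' := fun v => by simp
      smul_mem' := fun c a ha v => by
        rw [Prod.smul_fst, Prod.smul_snd, LinearMap.smul_apply, map_smul, ha v, smul_assoc] }
  let σ : Representation ℚ (GL ι ℤ) (V →ₗ[ℚ] E) := Representation.linHom ρV ρE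
  have hσ : ∀ γ φ v, σ γ φ v = ρE γ (φ (ρV γ⁻¹ v)) := fun γ φ v => rfl
  have hVinv : ∀ γ v, ρV γ (ρV γ⁻¹ v) = v := by
    intro γ v
    rw [← Module.End.mul_apply, ← map_mul, mul_inv_cancel, map_one, Module.End.one_apply]
  have hVinv2 : ∀ γ v, ρV γ⁻¹ (ρV γ v) = v := by
    intro γ v
    rw [← Module.End.mul_apply, ← map_mul, inv_mul_cancel, map_one, Module.End.one_apply]
  let r : GL ι ℤ →* Module.End ℚ A :=
    { toFun := fun γ => ((σ γ).prodMap LinearMap.id).restrict (p := A) (q := A) (by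
        intro q hq v
        change g (σ γ q.1 v) = q.2 • v
        rw [hσ, hg, hq, map_smul, hVinv])
      map_one' := by
        ext q
        · change σ 1 q.1.1 _ = _
          rw [map_one]; rfl
        · rfl
      map_mul' := fun γ δ => by
        ext q
        · change σ (γ * δ) q.1.1 _ = _
          rw [map_mul]; rfl
        · rfl }
  obtain ⟨s₀, hs₀⟩ := LinearMap.exists_rightInverse_of_surjective g (LinearMap.range_eq_top.mpr hsurj)
  obtain ⟨a, ha, ha1⟩ := exists_invariant_rat r h3 (LinearMap.snd ℚ _ _ ∘ₗ A.subtype)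
    (fun γ a => rfl) ⟨⟨(s₀, 1), fun v => by
      have := LinearMap.congr_fun hs₀ v
      simpa using this⟩, rfl⟩
  refine ⟨a.1.1, ?_, ?_⟩
  · intro γ v
    have h1 : σ γ a.1.1 = a.1.1 := congrArg (fun q : A => q.1.1) (ha γ)
    conv_lhs => rw [← h1]
    rw [hσ, hVinv2]
  · ext v
    have h1 := a.2 v
    have h2 : a.1.2 = 1 := ha1
    rw [h2, one_smul] at h1
    exact h1

end Rational
end GLnZ

/-!
Statement 7: For `n ≥ 3`, every short exact sequence `0 → W → E → V → 0` of
finite-dimensional ℚ-linear representations of `GL_n(ℤ)` splits: there is an equivariant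
linear section of the surjection `E → V`.
-/

theorem statement_7 (n : ℕ) (hn : 3 ≤ n)
    (W E V : Type) [AddCommGroup W] [Module ℚ W] [FiniteDimensional ℚ W]
    [AddCommGroup E] [Module ℚ E] [FiniteDimensional ℚ E]
    [AddCommGroup V] [Module ℚ V] [FiniteDimensional ℚ V]
    (ρW : Representation ℚ (GL (Fin n) ℤ) W)
    (ρE : Representation ℚ (GL (Fin n) ℤ) E)
    (ρV : Representation ℚ (GL (Fin n) ℤ) V)
    (f : W →ₗ[ℚ] E) (g : E →ₗ[ℚ] V)
    (hf : ∀ (γ : GL (Fin n) ℤ) (w : W), f (ρW γ w) = ρE γ (f w))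
    (hg : ∀ (γ : GL (Fin n) ℤ) (e : E), g (ρE γ e) = ρV γ (g e))
    (hinj : Function.Injective f) (hsurj : Function.Surjective g)
    (hexact : LinearMap.range f = LinearMap.ker g) :
    ∃ s : V →ₗ[ℚ] E,
      (∀ (γ : GL (Fin n) ℤ) (v : V), s (ρV γ v) = ρE γ (s v)) ∧
      g ∘ₗ s = LinearMap.id := by
  refine GLnZ.exists_section ?_ ρE ρV g hg hsurj
  intro i j
  have hc : ({i, j} : Finset (Fin n)).card < (Finset.univ : Finset (Fin n)).card := by
    rw [Finset.card_univ, Fintype.card_fin]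
    exact lt_of_le_of_lt Finset.card_le_two (by omega)
  obtain ⟨k, _, hk⟩ := Finset.exists_mem_notMem_of_card_lt_card hc
  simp only [Finset.mem_insert, Finset.mem_singleton, not_or] at hk
  exact ⟨k, hk.1, hk.2⟩
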